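/- arXiv:1512.00234 — 11 statements merged into one kernel-verified Lean document; each statement's English description precedes it below -/
import Mathlib

section
/- Let 0 < a ≤ 1. The Hurwitz zeta function ζ(σ,a) (the analytic continuation of ∑_{n≥0} (n+a)^{-σ}) is nonzero for every real σ in the open interval (-1,0) if and only if (3-√3)/6 ≤ a ≤ 1/2 or (3+√3)/6 ≤ a ≤ 1. -/
open HurwitzZeta Real
open Set MeasureTheory Filter Topology

lemma sinh_le_mul_exp {w : ℝ} (hw : 0 ≤ w) : sinh w ≤ w * exp (w ^ 2 / 6) := by
  have h := (NormedSpace.expSeries_div_hasSum_exp (𝔸 := ℝ) (w ^ 2 / 6)).mul_left w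
  rw [← Real.exp_eq_exp_ℝ] at h
  refine hasSum_le (fun n ↦ ?_) (Real.hasSum_sinh w) h
  have key : ∀ n : ℕ, (6 : ℝ) ^ n * n.factorial ≤ (2 * n + 1).factorial := by
    intro n
    induction n with
    | zero => simp
    | succ n ih =>
      rw [show 2 * (n + 1) + 1 = (2 * n + 1) + 1 + 1 by ring, Nat.factorial_succ (2 * n + 1 + 1),
        Nat.factorial_succ (2 * n + 1), Nat.factorial_succ n]
      push_cast
      have h1 : (0 : ℝ) ≤ (2 * n + 1).factorial := by positivity
      have h2 : (0 : ℝ) ≤ n := by positivity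
      calc (6 : ℝ) ^ (n + 1) * ((n + 1) * n.factorial)
          = (6 * (n + 1)) * (6 ^ n * n.factorial) := by ring
        _ ≤ (6 * (n + 1)) * (2 * n + 1).factorial := by gcongr
        _ ≤ ((2 * n + 1 + 1 + 1) * (2 * n + 1 + 1)) * (2 * n + 1).factorial := by
          refine mul_le_mul_of_nonneg_right ?_ h1
          nlinarith
        _ = _ := by ring
  rw [div_pow, ← pow_mul, div_div, ← mul_div_assoc, ← pow_succ']
  gcongr
  exact key n

lemma one_sub_lt_exp {v : ℝ} (hv : 0 < v) : 1 - v < exp (-v - v ^ 2 / 2) := by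
  rcases le_or_gt 1 v with h | h
  · linarith [exp_pos (-v - v ^ 2 / 2)]
  have h1 := Real.hasSum_pow_div_log_of_abs_lt_one (abs_lt.2 ⟨by linarith, h⟩)
  have h2 := h1.summable.sum_le_tsum (Finset.range 3) (fun i _ ↦ by positivity)
  rw [h1.tsum_eq] at h2
  norm_num [Finset.sum_range_succ] at h2
  have : 0 < v ^ 3 := by positivity
  rw [← Real.log_lt_iff_lt_exp (by linarith)]
  linarith

lemma mul_cosh_lt_sinh {u w : ℝ} (hw : 0 < w) (h : 3 * u ^ 2 ≤ w ^ 2) :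
    w * cosh u < sinh w := by
  have key : ∀ n : ℕ, 2 * n + 1 ≤ 3 ^ n := by
    intro n
    induction n with
    | zero => simp
    | succ n ih => rw [pow_succ]; lia
  have hf : ∀ n : ℕ, ((2 * n + 1).factorial : ℝ) = (2 * n + 1) * (2 * n).factorial := by
    intro n; rw [Nat.factorial_succ]; push_cast; ring
  refine hasSum_lt (i := 2) (fun n ↦ ?_) ?_ ((Real.hasSum_cosh u).mul_left w) (Real.hasSum_sinh w)
  · rw [← mul_div_assoc, pow_succ', hf, div_le_div_iff₀ (by positivity) (by positivity)]
    have h3 : ((2 * n + 1 : ℕ) : ℝ) ≤ (3 : ℝ) ^ n := mod_cast key n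
    push_cast at h3
    have h4 : (2 * n + 1) * u ^ (2 * n) ≤ w ^ (2 * n) := by
      calc (2 * n + 1) * u ^ (2 * n) ≤ 3 ^ n * u ^ (2 * n) := by
            gcongr
            rw [pow_mul]; positivity
        _ = (3 * u ^ 2) ^ n := by rw [mul_pow, pow_mul]
        _ ≤ (w ^ 2) ^ n := by gcongr
        _ = w ^ (2 * n) := by rw [pow_mul]
    calc w * u ^ (2 * n) * ((2 * n + 1) * (2 * n).factorial)
        = ((2 * n + 1) * u ^ (2 * n)) * (w * (2 * n).factorial) := by ring
      _ ≤ w ^ (2 * n) * (w * (2 * n).factorial) := by gcongr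
      _ = _ := by ring
  · have h5 : 9 * u ^ 4 ≤ w ^ 4 := by nlinarith [sq_nonneg u, sq_nonneg w]
    have h6 : 0 < w ^ 4 := by positivity
    norm_num [Nat.factorial]
    have : 0 < w * (w ^ 4 / 120 - u ^ 4 / 24) := mul_pos hw (by linarith)
    nlinarith

lemma mul_sinh_le_mul_sinh {u w : ℝ} (hu : 0 ≤ u) (h : u ≤ w) :
    w * sinh u ≤ u * sinh w := by
  refine hasSum_le (fun n ↦ ?_) ((Real.hasSum_sinh u).mul_left w) ((Real.hasSum_sinh w).mul_left u)
  have : u ^ (2 * n) ≤ w ^ (2 * n) := by gcongr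
  have h2 : 0 ≤ u * w := mul_nonneg hu (hu.trans h)
  rw [← mul_div_assoc, ← mul_div_assoc]
  gcongr ?_ / _
  rw [pow_succ, pow_succ]
  nlinarith

/-- The integrand of the Mellin transform representing `Γ(s) ζ(s, a)`. -/
noncomputable def hurwitzKernel (a t : ℝ) : ℝ := exp (-a * t) / (1 - exp (-t))

lemma hurwitzKernel_sub_eq (a : ℝ) {t : ℝ} (ht : 0 < t) :
    hurwitzKernel a t - (1 / t + (1 / 2 - a)) =
      (t * exp ((1 / 2 - a) * t) - 2 * sinh (t / 2) * (1 + (1 / 2 - a) * t)) /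
        (2 * t * sinh (t / 2)) := by
  have hs : 0 < sinh (t / 2) := Real.sinh_pos_iff.2 (by linarith)
  have h1 : 1 - exp (-t) = 2 * sinh (t / 2) * exp (-(t / 2)) := by
    rw [Real.sinh_eq, show -t = -(t / 2) + -(t / 2) by ring, exp_add]
    have : exp (t / 2) * exp (-(t / 2)) = 1 := by rw [← exp_add]; simp
    linear_combination -this
  have h2 : exp (-a * t) = exp ((1 / 2 - a) * t) * exp (-(t / 2)) := by
    rw [← exp_add]; congr 1; ring
  rw [hurwitzKernel, h1, h2, mul_div_mul_right _ _ (exp_pos _).ne']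
  field_simp

lemma hurwitzKernel_sub_neg {a t : ℝ} (ht : 0 < t) (ha : a ≤ 1 / 2)
    (h : a ^ 2 - a + 1 / 6 ≤ 0) : hurwitzKernel a t - (1 / t + (1 / 2 - a)) < 0 := by
  have hs : 0 < sinh (t / 2) := Real.sinh_pos_iff.2 (by linarith)
  rw [hurwitzKernel_sub_eq a ht]
  refine div_neg_of_neg_of_pos ?_ (by positivity)
  set u := (1 / 2 - a) * t with hu
  have hu0 : 0 ≤ u := mul_nonneg (by linarith) ht.le
  have hsq : 3 * u ^ 2 ≤ (t / 2) ^ 2 := by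
    rw [hu]; nlinarith [sq_nonneg t]
  have hle : u ≤ t / 2 := by nlinarith
  have h1 := mul_cosh_lt_sinh (by linarith : 0 < t / 2) hsq
  have h2 := mul_sinh_le_mul_sinh hu0 hle
  rw [← Real.cosh_add_sinh u]
  nlinarith

lemma hurwitzKernel_sub_pos {a t : ℝ} (ht : 0 < t) (ha : 1 / 2 ≤ a)
    (h : 0 ≤ a ^ 2 - a + 1 / 6) : 0 < hurwitzKernel a t - (1 / t + (1 / 2 - a)) := by
  have hs : 0 < sinh (t / 2) := Real.sinh_pos_iff.2 (by linarith)
  rw [hurwitzKernel_sub_eq a ht]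
  refine div_pos ?_ (by positivity)
  obtain ⟨v, hv⟩ : ∃ v, v = (a - 1 / 2) * t := ⟨_, rfl⟩
  have ha2 : 1 / 2 < a := lt_of_le_of_ne ha (by rintro rfl; norm_num at h)
  have hv0 : 0 < v := hv ▸ mul_pos (by linarith) ht
  rw [show (1 / 2 - a) * t = -v by rw [hv]; ring]
  have hsq : t ^ 2 ≤ 12 * v ^ 2 := by
    rw [hv]; nlinarith [sq_nonneg t]
  have hE := exp_pos (-v)
  rcases le_or_gt 1 v with h1 | h1
  · nlinarith [mul_pos ht hE, mul_nonneg hs.le (sub_nonneg.2 h1)]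
  have h2 := sinh_le_mul_exp (by linarith : 0 ≤ t / 2)
  have h3 : exp ((t / 2) ^ 2 / 6) ≤ exp (v ^ 2 / 2) := exp_le_exp.2 (by linarith)
  have h4 := one_sub_lt_exp hv0
  rw [exp_sub, lt_div_iff₀ (exp_pos _)] at h4
  have : 2 * sinh (t / 2) * (1 - v) < t * exp (-v) := by
    calc 2 * sinh (t / 2) * (1 - v) ≤ 2 * (t / 2 * exp (v ^ 2 / 2)) * (1 - v) := by
          have : 0 ≤ 1 - v := by linarith
          gcongr
          exact h2.trans (by gcongr)
      _ = t * ((1 - v) * exp (v ^ 2 / 2)) := by ring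
      _ < _ := by gcongr
  linarith

lemma abs_hurwitzKernel_sub_le {a t : ℝ} (ha : 0 < a) (ha' : a ≤ 1) (ht : 0 < t) (ht' : t ≤ 1) :
    |hurwitzKernel a t - (1 / t + (1 / 2 - a))| ≤ 2 * t := by
  have hs : 0 < sinh (t / 2) := Real.sinh_pos_iff.2 (by linarith)
  have hs1 : t / 2 ≤ sinh (t / 2) := Real.self_le_sinh_iff.2 (by linarith)
  have hs2 : sinh (t / 2) ≤ t / 2 + t ^ 3 / 24 := by
    have h1 := sinh_le_mul_exp (by linarith : 0 ≤ t / 2)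
    have h2 := Real.abs_exp_sub_one_le (x := (t / 2) ^ 2 / 6)
      (by rw [abs_of_nonneg (by positivity)]; nlinarith)
    rw [abs_of_nonneg (a := (t / 2) ^ 2 / 6) (by positivity)] at h2
    have h3 := (abs_le.1 h2).2
    have h4 := mul_le_mul_of_nonneg_left h3 ht.le
    nlinarith
  rw [hurwitzKernel_sub_eq a ht, abs_div, abs_of_pos (a := 2 * t * sinh (t / 2)) (by positivity),
    div_le_iff₀ (by positivity)]
  obtain ⟨c, hc⟩ : ∃ c, c = 1 / 2 - a := ⟨_, rfl⟩
  rw [← hc]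
  have hc1 : |c| ≤ 1 / 2 := abs_le.2 ⟨by linarith, by linarith⟩
  have hct : |c * t| ≤ 1 / 2 := by
    rw [abs_mul, abs_of_pos ht]; nlinarith [abs_nonneg c]
  have hexp := Real.abs_exp_sub_one_sub_id_le (x := c * t) (hct.trans (by norm_num))
  have hsq : (c * t) ^ 2 ≤ t ^ 2 / 4 := by
    have : c ^ 2 ≤ 1 / 4 := by rw [← sq_abs c]; nlinarith [abs_nonneg c]
    rw [mul_pow]; nlinarith [sq_nonneg t]
  have h1 : |t * (exp (c * t) - 1 - c * t)| ≤ t ^ 3 / 4 := by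
    rw [abs_mul, abs_of_pos ht]; nlinarith
  have h2 : |(2 * sinh (t / 2) - t) * (1 + c * t)| ≤ t ^ 3 / 8 := by
    rw [abs_mul, abs_of_nonneg (by linarith)]
    have := abs_le.1 hct
    rw [abs_of_nonneg (by linarith)]
    nlinarith [pow_pos ht 3]
  have h3 : t * exp (c * t) - 2 * sinh (t / 2) * (1 + c * t) =
    t * (exp (c * t) - 1 - c * t) - (2 * sinh (t / 2) - t) * (1 + c * t) := by ring
  rw [h3]
  refine (abs_sub _ _).trans ?_
  nlinarith [pow_pos ht 2, pow_pos ht 3, mul_le_mul_of_nonneg_left hs1 (sq_nonneg t)]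

/-- `hurwitzKernel a` minus the singular and constant parts of its expansion at `0`, on `(0, 1]`. -/
noncomputable def hurwitzKernelReg (a t : ℝ) : ℝ :=
  hurwitzKernel a t - (Ioc 0 1).indicator (fun t ↦ 1 / t + (1 / 2 - a)) t

lemma continuousOn_hurwitzKernel (a : ℝ) : ContinuousOn (hurwitzKernel a) (Ioi 0) := by
  unfold hurwitzKernel
  refine ContinuousOn.div (by fun_prop) (by fun_prop) fun t (ht : 0 < t) ↦ ?_
  have := Real.exp_lt_one_iff.2 (neg_lt_zero.2 ht)
  linarith

lemma locallyIntegrableOn_hurwitzKernelReg (a : ℝ) :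
    LocallyIntegrableOn (fun t ↦ (hurwitzKernelReg a t : ℂ)) (Ioi 0) := by
  have h1 : LocallyIntegrableOn (hurwitzKernel a) (Ioi 0) :=
    (continuousOn_hurwitzKernel a).locallyIntegrableOn measurableSet_Ioi
  have h2 : LocallyIntegrableOn (fun t : ℝ ↦ 1 / t + (1 / 2 - a)) (Ioi 0) := by
    refine ContinuousOn.locallyIntegrableOn ?_ measurableSet_Ioi
    exact (continuousOn_const.div continuousOn_id fun t (ht : 0 < t) ↦ ht.ne').add
      continuousOn_const
  intro x hx
  obtain ⟨U, hU, hi⟩ := h1 x hx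
  obtain ⟨V, hV, hj⟩ := h2 x hx
  refine ⟨U ∩ V, inter_mem hU hV, ?_⟩
  exact ((hi.mono_set inter_subset_left).sub
    ((hj.mono_set inter_subset_right).indicator measurableSet_Ioc)).ofReal

lemma isBigO_atTop_hurwitzKernelReg (a : ℝ) :
    (fun t ↦ (hurwitzKernelReg a t : ℂ)) =O[atTop] fun t ↦ exp (-a * t) := by
  refine Asymptotics.IsBigO.of_bound (1 - exp (-1))⁻¹ ?_
  filter_upwards [eventually_gt_atTop 1] with t ht
  have h1 : exp (-t) ≤ exp (-1) := exp_le_exp.2 (by linarith)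
  have h2 : exp (-1) < 1 := Real.exp_lt_one_iff.2 (by norm_num)
  have h3 : 0 < 1 - exp (-t) := by linarith
  rw [hurwitzKernelReg, indicator_of_notMem (fun h ↦ absurd h.2 (by linarith)), sub_zero,
    Complex.norm_real, norm_eq_abs, norm_eq_abs, abs_exp, hurwitzKernel, abs_div, abs_exp,
    abs_of_pos h3, div_eq_inv_mul]
  gcongr

lemma isBigO_zero_hurwitzKernelReg {a : ℝ} (ha : 0 < a) (ha' : a ≤ 1) :
    (fun t ↦ (hurwitzKernelReg a t : ℂ)) =O[𝓝[>] 0] fun t : ℝ ↦ t ^ (-(-1) : ℝ) := by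
  refine Asymptotics.IsBigO.of_bound 2 ?_
  filter_upwards [Ioc_mem_nhdsGT (zero_lt_one (α := ℝ))] with t ht
  rw [hurwitzKernelReg, indicator_of_mem ht, Complex.norm_real, neg_neg, rpow_one, norm_eq_abs,
    norm_eq_abs, abs_of_pos ht.1]
  exact abs_hurwitzKernel_sub_le ha ha' ht.1 ht.2

lemma mellinConvergent_hurwitzKernelReg {a : ℝ} (ha : 0 < a) (ha' : a ≤ 1) {s : ℂ}
    (hs : -1 < s.re) : MellinConvergent (fun t ↦ (hurwitzKernelReg a t : ℂ)) s :=
  mellinConvergent_of_isBigO_rpow_exp ha (locallyIntegrableOn_hurwitzKernelReg a)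
    (isBigO_atTop_hurwitzKernelReg a) (isBigO_zero_hurwitzKernelReg ha ha') hs

lemma differentiableAt_mellin_hurwitzKernelReg {a : ℝ} (ha : 0 < a) (ha' : a ≤ 1) {s : ℂ}
    (hs : -1 < s.re) : DifferentiableAt ℂ (mellin fun t ↦ (hurwitzKernelReg a t : ℂ)) s :=
  mellin_differentiableAt_of_isBigO_rpow_exp ha (locallyIntegrableOn_hurwitzKernelReg a)
    (isBigO_atTop_hurwitzKernelReg a) (isBigO_zero_hurwitzKernelReg ha ha') hs

lemma mellin_hurwitzKernel {a : ℝ} (ha : 0 < a) (ha' : a ≤ 1) {s : ℂ} (hs : 1 < s.re) :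
    mellin (fun t ↦ (hurwitzKernel a t : ℂ)) s =
      mellin (fun t ↦ (hurwitzKernelReg a t : ℂ)) s + (1 / (s - 1) + (1 / 2 - a) / s) := by
  have h0 := mellinConvergent_hurwitzKernelReg ha ha' (by linarith : -1 < s.re)
  have h1 := hasMellin_cpow_Ioc (-1) (s := s) (by simpa using hs)
  have h2 := hasMellin_one_Ioc (by linarith : 0 < s.re)
  have h3 := hasMellin_const_smul h2.1 (1 / 2 - a : ℂ)
  have h4 := hasMellin_add h1.1 h3.1
  have h5 := hasMellin_add h0 h4.1
  rw [h4.2, h1.2, h3.2, h2.2] at h5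
  rw [div_eq_mul_one_div _ s, sub_eq_add_neg s, ← smul_eq_mul, ← h5.2]
  congr 1
  ext t
  by_cases ht : t ∈ Ioc (0 : ℝ) 1
  · simp [hurwitzKernelReg, indicator_of_mem ht, Complex.cpow_neg_one]
  · simp [hurwitzKernelReg, indicator_of_notMem ht]

lemma mellin_hurwitzKernel_eq_Gamma_mul {a : ℝ} (ha : 0 < a) (ha' : a ≤ 1) {s : ℂ}
    (hs : 1 < s.re) :
    mellin (fun t ↦ (hurwitzKernel a t : ℂ)) s = Complex.Gamma s * hurwitzZeta a s := by
  have hz := hasSum_hurwitzZeta_of_one_lt_re (a := a) ⟨ha.le, ha'⟩ hs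
  have hF : ∀ t ∈ Ioi (0 : ℝ), HasSum (fun n : ℕ ↦ (1 : ℂ) * exp (-(n + a) * t))
      (hurwitzKernel a t : ℂ) := by
    intro t (ht : 0 < t)
    have h := (hasSum_geometric_of_lt_one (exp_pos (-t)).le
      (Real.exp_lt_one_iff.2 (neg_lt_zero.2 ht))).mul_left (exp (-a * t))
    rw [← div_eq_mul_inv] at h
    refine (Complex.hasSum_ofReal.2 h).congr_fun ?_
    intro n
    rw [one_mul, ← Real.exp_nat_mul, ← exp_add]
    congr 2
    ring
  have hsum : Summable fun n : ℕ ↦ ‖(1 : ℂ)‖ / ((n : ℝ) + a) ^ s.re := by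
    refine hz.summable.norm.congr fun n ↦ ?_
    rw [norm_div, norm_one, ← Complex.ofReal_natCast, ← Complex.ofReal_add,
      Complex.norm_cpow_eq_rpow_re_of_pos (by positivity)]
  have h := hasSum_mellin (fun n : ℕ ↦ Or.inr (by positivity : 0 < (n : ℝ) + a))
    (by linarith) hF hsum
  refine h.unique ?_
  refine (hz.mul_left (Complex.Gamma s)).congr_fun fun n ↦ ?_
  push_cast
  ring

/-- Integral representation of the continuation of the Hurwitz zeta function to `-1 < Re s`. -/
lemma hurwitzZeta_eq_mellin {a : ℝ} (ha : 0 < a) (ha' : a ≤ 1) {s : ℂ} (hs : -1 < s.re)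
    (hs1 : s ≠ 1) :
    hurwitzZeta a s = (Complex.Gamma s)⁻¹ * mellin (fun t ↦ (hurwitzKernelReg a t : ℂ)) s +
      (1 / 2 - a) * (Complex.Gamma (s + 1))⁻¹ + (Complex.Gamma s)⁻¹ / (s - 1) := by
  set U : Set ℂ := {s | -1 < s.re} with hU
  have hUo : IsOpen U := isOpen_lt continuous_const Complex.continuous_re
  have hUc : IsPreconnected U := (convex_halfSpace_re_gt (-1)).isPreconnected
  set G : ℂ → ℂ := Function.update (fun s ↦ (s - 1) * hurwitzZeta a s) 1 1 with hG
  set R : ℂ → ℂ := fun s ↦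
    (s - 1) * ((Complex.Gamma s)⁻¹ * mellin (fun t ↦ (hurwitzKernelReg a t : ℂ)) s +
      (1 / 2 - a) * (Complex.Gamma (s + 1))⁻¹) + (Complex.Gamma s)⁻¹ with hR
  have hGd : DifferentiableOn ℂ G U := by
    have h1U : U ∈ 𝓝 (1 : ℂ) := hUo.mem_nhds (by simp [hU])
    rw [← Complex.differentiableOn_compl_singleton_and_continuousAt_iff h1U]
    refine ⟨fun z hz ↦ ?_, continuousAt_update_same.2 (hurwitzZeta_residue_one a)⟩
    have hz1 : z ≠ 1 := hz.2
    have hd : DifferentiableAt ℂ (fun s ↦ (s - 1) * hurwitzZeta a s) z :=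
      (differentiableAt_id.sub_const 1).mul (differentiableAt_hurwitzZeta a hz1)
    refine (hd.congr_of_eventuallyEq ?_).differentiableWithinAt
    filter_upwards [isOpen_ne.mem_nhds hz1] with w hw
    exact Function.update_of_ne hw _ _
  have hRd : DifferentiableOn ℂ R U := by
    intro z hz
    have hΓ := Complex.differentiable_one_div_Gamma
    have hm := differentiableAt_mellin_hurwitzKernelReg ha ha' hz
    have hΓ' : DifferentiableAt ℂ (fun s : ℂ ↦ (Complex.Gamma (s + 1))⁻¹) z :=
      
      (hΓ.comp (differentiable_id.add_const (1 : ℂ))) z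
    exact (((differentiableAt_id.sub_const 1).mul
      (((hΓ z).mul hm).add (hΓ'.const_mul _))).add (hΓ z)).differentiableWithinAt
  have h2U : (2 : ℂ) ∈ U := by simp only [hU, mem_ofPred_eq]; norm_num
  have hev : G =ᶠ[𝓝 2] R := by
    have : {s : ℂ | 1 < s.re} ∈ 𝓝 (2 : ℂ) :=
      (isOpen_lt continuous_const Complex.continuous_re).mem_nhds (by norm_num)
    filter_upwards [this] with z (hz : 1 < z.re)
    have hz1 : z ≠ 1 := by rintro rfl; simp at hz
    have hz0 : z ≠ 0 := by rintro rfl; norm_num at hz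
    have hΓ0 : Complex.Gamma z ≠ 0 := Complex.Gamma_ne_zero_of_re_pos (by linarith)
    have hz1' : z - 1 ≠ 0 := sub_ne_zero.2 hz1
    have h := mellin_hurwitzKernel ha ha' hz
    rw [mellin_hurwitzKernel_eq_Gamma_mul ha ha' hz] at h
    simp only [hG, hR, Function.update_of_ne hz1, Complex.Gamma_add_one z hz0]
    field_simp
    field_simp at h
    linear_combination h
  have hGR := (hGd.analyticOnNhd hUo).eqOn_of_preconnected_of_eventuallyEq
    (hRd.analyticOnNhd hUo) hUc h2U hev hs
  simp only [hG, hR, Function.update_of_ne hs1] at hGR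
  have hs1' : s - 1 ≠ 0 := sub_ne_zero.2 hs1
  refine mul_left_cancel₀ hs1' (hGR.trans ?_)
  field_simp

lemma hurwitzZeta_apply_zero {a : ℝ} (ha : 0 < a) (ha' : a ≤ 1) :
    hurwitzZeta a 0 = 1 / 2 - a := by
  rw [hurwitzZeta_eq_mellin ha ha' (by simp) zero_ne_one]
  simp [Complex.Gamma_zero]

lemma hurwitzZeta_apply_neg_one {a : ℝ} (ha : 0 < a) (ha' : a ≤ 1) :
    hurwitzZeta a (-1) = ((-(a ^ 2 - a + 1 / 6) / 2 : ℝ) : ℂ) := by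
  have h := hurwitzZeta_neg_nat one_ne_zero (⟨ha.le, ha'⟩ : a ∈ Icc (0 : ℝ) 1)
  rw [Nat.cast_one] at h
  rw [h]
  simp [Polynomial.bernoulli_def, Finset.sum_range_succ, bernoulli_one, bernoulli_two]
  ring

lemma Gamma_ne_zero_of_mem_Ioo {σ : ℝ} (hσ : σ ∈ Ioo (-1) 0) : Gamma σ ≠ 0 := by
  refine Real.Gamma_ne_zero fun m hm ↦ ?_
  obtain ⟨h1, h0⟩ := hσ
  rcases m with _ | m
  · simp at hm; linarith
  · push_cast at hm
    have : (0 : ℝ) ≤ m := by positivity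
    linarith

lemma Gamma_mul_hurwitzZeta_eq_integral_s0 {a σ : ℝ} (ha : 0 < a) (ha' : a ≤ 1) (h1 : -1 < σ)
    (h0 : σ < 0) :
    IntegrableOn (fun t ↦ t ^ (σ - 1) * (hurwitzKernel a t - (1 / t + (1 / 2 - a)))) (Ioi 0) ∧
    (Gamma σ : ℂ) * hurwitzZeta a σ =
      ((∫ t in Ioi 0, t ^ (σ - 1) * (hurwitzKernel a t - (1 / t + (1 / 2 - a))) : ℝ) : ℂ) := by
  have hpow : ∀ t ∈ Ioi (0 : ℝ), (t : ℂ) ^ ((σ : ℂ) - 1) • (hurwitzKernelReg a t : ℂ) =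
      ((t ^ (σ - 1) * hurwitzKernelReg a t : ℝ) : ℂ) := by
    intro t (ht : 0 < t)
    rw [Complex.ofReal_mul, Complex.ofReal_cpow ht.le]
    simp
  have hconv := mellinConvergent_hurwitzKernelReg ha ha' (s := σ) (by simpa using h1)
  have hint : IntegrableOn (fun t ↦ t ^ (σ - 1) * hurwitzKernelReg a t) (Ioi 0) := by
    simpa [IntegrableOn] using (IntegrableOn.congr_fun hconv hpow measurableSet_Ioi).re
  have hmel : mellin (fun t ↦ (hurwitzKernelReg a t : ℂ)) σ =
      ((∫ t in Ioi 0, t ^ (σ - 1) * hurwitzKernelReg a t : ℝ) : ℂ) := by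
    rw [mellin, setIntegral_congr_fun measurableSet_Ioi hpow]
    exact integral_ofReal
  have hi1 := integrableOn_Ioi_rpow_of_lt (by linarith : σ - 2 < -1) zero_lt_one
  have hi2 := (integrableOn_Ioi_rpow_of_lt (by linarith : σ - 1 < -1) zero_lt_one).const_mul
    (1 / 2 - a)
  have hi3 := hi1.add hi2
  have hval : ∫ t in Ioi (1 : ℝ), (t ^ (σ - 2) + (1 / 2 - a) * t ^ (σ - 1)) =
      -(1 / (σ - 1)) - (1 / 2 - a) / σ := by
    rw [integral_add hi1 hi2, integral_const_mul,
      integral_Ioi_rpow_of_lt (by linarith) zero_lt_one,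
      integral_Ioi_rpow_of_lt (by linarith) zero_lt_one, one_rpow, one_rpow,
      show σ - 2 + 1 = σ - 1 by ring, show σ - 1 + 1 = σ by ring]
    ring
  have hIoi : Ioi (1 : ℝ) ∩ Ioi 0 = Ioi 1 := inter_eq_left.2 (Ioi_subset_Ioi zero_le_one)
  have hi4 : IntegrableOn ((Ioi (1 : ℝ)).indicator
      fun t ↦ t ^ (σ - 2) + (1 / 2 - a) * t ^ (σ - 1)) (Ioi 0) :=
    (IntegrableOn.integrable_indicator hi3 measurableSet_Ioi).integrableOn
  have hval' : ∫ t in Ioi (0 : ℝ), (Ioi (1 : ℝ)).indicator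
      (fun t ↦ t ^ (σ - 2) + (1 / 2 - a) * t ^ (σ - 1)) t =
      -(1 / (σ - 1)) - (1 / 2 - a) / σ := by
    rw [setIntegral_indicator measurableSet_Ioi, inter_comm, hIoi, hval]
  have hdecomp : ∀ t ∈ Ioi (0 : ℝ), t ^ (σ - 1) * hurwitzKernelReg a t - (Ioi (1 : ℝ)).indicator
      (fun t ↦ t ^ (σ - 2) + (1 / 2 - a) * t ^ (σ - 1)) t =
      t ^ (σ - 1) * (hurwitzKernel a t - (1 / t + (1 / 2 - a))) := by
    intro t (ht : 0 < t)
    rw [hurwitzKernelReg]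
    rcases le_or_gt t 1 with h | h
    · rw [indicator_of_mem (show t ∈ Ioc (0 : ℝ) 1 from ⟨ht, h⟩), indicator_of_notMem (by simpa using h), sub_zero]
    · rw [indicator_of_notMem (fun h' ↦ absurd h'.2 (by linarith)), indicator_of_mem (show t ∈ Ioi (1 : ℝ) from h),
        show σ - 2 = σ - 1 - 1 by ring, rpow_sub_one ht.ne' (σ - 1)]
      ring
  refine ⟨(hint.sub hi4).congr_fun hdecomp measurableSet_Ioi, ?_⟩
  rw [← setIntegral_congr_fun measurableSet_Ioi hdecomp, integral_sub hint hi4, hval',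
    hurwitzZeta_eq_mellin ha ha' (by simpa using h1)
      (by norm_cast; linarith), hmel, ← Complex.Gamma_ofReal]
  have hσ : (σ : ℂ) ≠ 0 := by exact_mod_cast h0.ne
  have hσ1 : (σ : ℂ) - 1 ≠ 0 := sub_ne_zero.2 (by norm_cast; linarith)
  have hΓ : Complex.Gamma σ ≠ 0 := by
    rw [Complex.Gamma_ofReal]
    exact Complex.ofReal_ne_zero.2 (Gamma_ne_zero_of_mem_Ioo ⟨h1, h0⟩)
  rw [Complex.Gamma_add_one _ hσ]
  push_cast
  field_simp
  ring

lemma integral_rpow_mul_ne_zero_of_pos {s : ℝ} {g : ℝ → ℝ}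
    (hi : IntegrableOn (fun t ↦ t ^ s * g t) (Ioi 0)) (hg : ∀ t, 0 < t → 0 < g t) :
    ∫ t in Ioi 0, t ^ s * g t ≠ 0 := by
  have hpos : ∀ t ∈ Ioi (0 : ℝ), 0 < t ^ s * g t := fun t (ht : 0 < t) ↦
    mul_pos (rpow_pos_of_pos ht _) (hg t ht)
  refine ((setIntegral_pos_iff_support_of_nonneg_ae ?_ hi).2 ?_).ne'
  · exact (ae_restrict_iff' measurableSet_Ioi).2 (.of_forall fun t ht ↦ (hpos t ht).le)
  · rw [inter_eq_right.2 fun t ht ↦ Function.mem_support.2 (hpos t ht).ne']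
    simp

lemma hurwitzZeta_ne_zero_of_integral_ne_zero {a σ : ℝ} (ha : 0 < a) (ha' : a ≤ 1) (h1 : -1 < σ)
    (h0 : σ < 0)
    (h : ∫ t in Ioi 0, t ^ (σ - 1) * (hurwitzKernel a t - (1 / t + (1 / 2 - a))) ≠ 0) :
    hurwitzZeta a σ ≠ 0 := by
  intro hz
  have := (Gamma_mul_hurwitzZeta_eq_integral_s0 ha ha' h1 h0).2
  rw [hz, mul_zero, eq_comm, Complex.ofReal_eq_zero] at this
  exact h this

lemma hurwitzZeta_ne_zero_of_le_half {a σ : ℝ} (ha : 0 < a) (ha' : a ≤ 1 / 2)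
    (hB : a ^ 2 - a + 1 / 6 ≤ 0) (h1 : -1 < σ) (h0 : σ < 0) : hurwitzZeta a σ ≠ 0 := by
  have ha1 : a ≤ 1 := by linarith
  refine hurwitzZeta_ne_zero_of_integral_ne_zero ha ha1 h1 h0 fun h ↦ ?_
  have hi := (Gamma_mul_hurwitzZeta_eq_integral_s0 ha ha1 h1 h0).1.neg
  refine integral_rpow_mul_ne_zero_of_pos (s := σ - 1)
    (g := fun t ↦ -(hurwitzKernel a t - (1 / t + (1 / 2 - a)))) ?_
    (fun t ht ↦ neg_pos.2 (hurwitzKernel_sub_neg ht ha' hB)) ?_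
  · exact hi.congr_fun (fun t _ ↦ (mul_neg _ _).symm) measurableSet_Ioi
  · simp_rw [mul_neg, integral_neg, h, neg_zero]

lemma hurwitzZeta_ne_zero_of_half_le {a σ : ℝ} (ha : 1 / 2 ≤ a) (ha' : a ≤ 1)
    (hB : 0 ≤ a ^ 2 - a + 1 / 6) (h1 : -1 < σ) (h0 : σ < 0) : hurwitzZeta a σ ≠ 0 := by
  have ha0 : 0 < a := by linarith
  exact hurwitzZeta_ne_zero_of_integral_ne_zero ha0 ha' h1 h0 <|
    integral_rpow_mul_ne_zero_of_pos (Gamma_mul_hurwitzZeta_eq_integral_s0 ha0 ha' h1 h0).1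
      fun t ht ↦ hurwitzKernel_sub_pos ht ha hB

lemma hurwitzZeta_im_eq_zero {a σ : ℝ} (ha : 0 < a) (ha' : a ≤ 1) (h1 : -1 < σ) (h0 : σ < 0) :
    (hurwitzZeta a σ).im = 0 := by
  have h := congrArg Complex.im (Gamma_mul_hurwitzZeta_eq_integral_s0 ha ha' h1 h0).2
  rw [Complex.im_ofReal_mul, Complex.ofReal_im] at h
  exact (mul_eq_zero.1 h).resolve_left (Gamma_ne_zero_of_mem_Ioo ⟨h1, h0⟩)

/-- A strict sign change of the Hurwitz zeta function between `-1` and `0` produces a zero. -/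
lemma exists_hurwitzZeta_eq_zero {a : ℝ} (ha : 0 < a) (ha' : a ≤ 1)
    (h : 0 < (a ^ 2 - a + 1 / 6) * (1 / 2 - a)) :
    ∃ σ : ℝ, -1 < σ ∧ σ < 0 ∧ hurwitzZeta a σ = 0 := by
  have hcont : ContinuousOn (fun σ : ℝ ↦ (hurwitzZeta a σ).re) (Icc (-1) 0) := by
    intro σ hσ
    have hσ1 : (σ : ℂ) ≠ 1 := by
      norm_cast
      linarith [hσ.2]
    exact (Complex.continuous_re.continuousAt.comp
      ((differentiableAt_hurwitzZeta a hσ1).continuousAt.comp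
        Complex.continuous_ofReal.continuousAt)).continuousWithinAt
  have e0 : (hurwitzZeta a ((0 : ℝ) : ℂ)).re = 1 / 2 - a := by
    rw [Complex.ofReal_zero, hurwitzZeta_apply_zero ha ha']
    simp
  have e1 : (hurwitzZeta a ((-1 : ℝ) : ℂ)).re = -(a ^ 2 - a + 1 / 6) / 2 := by
    rw [Complex.ofReal_neg, Complex.ofReal_one, hurwitzZeta_apply_neg_one ha ha',
      Complex.ofReal_re]
  obtain ⟨σ, hσ, hz⟩ : ∃ σ ∈ Ioo (-1 : ℝ) 0, (hurwitzZeta a σ).re = 0 := by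
    rcases pos_and_pos_or_neg_and_neg_of_mul_pos h with ⟨h1, h2⟩ | ⟨h1, h2⟩
    · exact intermediate_value_Ioo (by norm_num) hcont ⟨by rw [e1]; linarith, by rw [e0]; linarith⟩
    · exact intermediate_value_Ioo' (by norm_num) hcont ⟨by rw [e0]; linarith, by rw [e1]; linarith⟩
  exact ⟨σ, hσ.1, hσ.2, Complex.ext hz (hurwitzZeta_im_eq_zero ha ha' hσ.1 hσ.2)⟩

theorem hurwitzZeta_ne_zero_on_neg_one_zero_iff (a : ℝ) (ha : 0 < a) (ha' : a ≤ 1) :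
    (∀ σ : ℝ, -1 < σ → σ < 0 → hurwitzZeta (a : UnitAddCircle) (σ : ℂ) ≠ 0) ↔
      ((3 - Real.sqrt 3) / 6 ≤ a ∧ a ≤ 1 / 2) ∨ ((3 + Real.sqrt 3) / 6 ≤ a ∧ a ≤ 1) := by
  have hs : Real.sqrt 3 ^ 2 = 3 := Real.sq_sqrt (by norm_num)
  have hs0 : 0 < Real.sqrt 3 := Real.sqrt_pos.2 (by norm_num)
  have hB : a ^ 2 - a + 1 / 6 = (a - (3 - Real.sqrt 3) / 6) * (a - (3 + Real.sqrt 3) / 6) := by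
    linear_combination (1 / 36) * hs
  constructor
  · intro h
    by_contra! hc
    obtain ⟨h1, h2⟩ := hc
    have h3 : a < (3 + Real.sqrt 3) / 6 := lt_of_not_ge fun h' ↦ absurd ha' (not_le.2 (h2 h'))
    obtain ⟨σ, hσ1, hσ0, hz⟩ := exists_hurwitzZeta_eq_zero ha ha' (by
      rw [hB]
      rcases lt_or_ge a ((3 - Real.sqrt 3) / 6) with h4 | h4
      · exact mul_pos (mul_pos_of_neg_of_neg (by linarith) (by linarith)) (by linarith)
      · have h5 := h1 h4
        exact mul_pos_of_neg_of_neg (mul_neg_of_pos_of_neg (by linarith) (by linarith))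
          (by linarith))
    exact h σ hσ1 hσ0 hz
  · rintro (⟨h1, h2⟩ | ⟨h1, -⟩) σ hσ1 hσ0
    · refine hurwitzZeta_ne_zero_of_le_half ha h2 ?_ hσ1 hσ0
      rw [hB]
      exact mul_nonpos_of_nonneg_of_nonpos (by linarith) (by linarith)
    · refine hurwitzZeta_ne_zero_of_half_le (by linarith) ha' ?_ hσ1 hσ0
      rw [hB]
      exact mul_nonneg (by linarith) (by linarith)
end

section
/- Let 0 < a ≤ 1, let z be a real number with -1 ≤ z < 1 satisfying (1-z)(1-a) ≤ 1, and let σ be real with -1 < σ < 0. Then (1/Γ(σ)) · ∫₀^∞ ( e^{(1-a)x}/(e^x - z) - 1/(1-z) ) x^{σ-1} dx > 0, where Γ is the real Gamma function. (This quantity equals the analytically continued Hurwitz–Lerch zeta value Φ(σ,a,z).) -/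
open Real MeasureTheory

lemma Gamma_neg_of_mem_Ioo {σ : ℝ} (hσ : -1 < σ) (hσ' : σ < 0) : Real.Gamma σ < 0 := by
  have h := Real.Gamma_add_one hσ'.ne
  have h1 : 0 < Real.Gamma (σ + 1) := Real.Gamma_pos_of_pos (by linarith)
  rw [h] at h1
  exact neg_of_mul_pos_right h1 hσ'.le

lemma mul_exp_mul_sub_one_lt {b c x : ℝ} (hb : 0 ≤ b) (hb' : b < 1) (hc : 0 < c)
    (hcb : c * b ≤ 1) (hx : 0 < x) :
    c * (Real.exp (b * x) - 1) < Real.exp x - 1 := by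
  have hx1 : 1 < Real.exp x := Real.one_lt_exp_iff.2 hx
  rcases hb.eq_or_lt with rfl | hb0
  · simpa using hx1
  · have h := strictConvexOn_exp.2 (Set.mem_univ x) (Set.mem_univ 0) hx.ne' hb0
      (sub_pos.2 hb') (by ring)
    simp only [smul_eq_mul, mul_zero, add_zero, Real.exp_zero, mul_one] at h
    calc c * (Real.exp (b * x) - 1) < c * (b * (Real.exp x - 1)) :=
          mul_lt_mul_of_pos_left (by linarith) hc
      _ = (c * b) * (Real.exp x - 1) := by ring
      _ ≤ Real.exp x - 1 := mul_le_of_le_one_left (by linarith) hcb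

lemma one_div_sub_exp_div_eq {b z x : ℝ} (hz : z < 1) (hx : 0 < x) :
    1 / (1 - z) - Real.exp (b * x) / (Real.exp x - z) =
      (Real.exp x - 1 - (1 - z) * (Real.exp (b * x) - 1)) / ((1 - z) * (Real.exp x - z)) := by
  have hx1 : 1 < Real.exp x := Real.one_lt_exp_iff.2 hx
  have h1 : 1 - z ≠ 0 := by linarith
  have h2 : Real.exp x - z ≠ 0 := by linarith
  field_simp
  ring

lemma one_div_sub_exp_div_pos {b z x : ℝ} (hb : 0 ≤ b) (hb' : b < 1) (hz : z < 1)
    (hcond : (1 - z) * b ≤ 1) (hx : 0 < x) :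
    0 < 1 / (1 - z) - Real.exp (b * x) / (Real.exp x - z) := by
  have hx1 : 1 < Real.exp x := Real.one_lt_exp_iff.2 hx
  rw [one_div_sub_exp_div_eq hz hx]
  have := mul_exp_mul_sub_one_lt hb hb' (sub_pos.2 hz) hcond hx
  exact div_pos (by linarith) (mul_pos (by linarith) (by linarith))

lemma one_div_sub_exp_div_le_one_div {b z x : ℝ} (hz : z < 1) (hx : 0 < x) :
    1 / (1 - z) - Real.exp (b * x) / (Real.exp x - z) ≤ 1 / (1 - z) := by
  have hx1 : 1 < Real.exp x := Real.one_lt_exp_iff.2 hx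
  have : 0 < Real.exp (b * x) / (Real.exp x - z) := div_pos (Real.exp_pos _) (by linarith)
  linarith

lemma one_div_sub_exp_div_le_mul {b z x : ℝ} (hb : 0 ≤ b) (hz : z < 1)
    (hx : 0 < x) (hx' : x ≤ 1) :
    1 / (1 - z) - Real.exp (b * x) / (Real.exp x - z) ≤ 2 / (1 - z) ^ 2 * x := by
  have hx1 : 1 < Real.exp x := Real.one_lt_exp_iff.2 hx
  have hz0 : 0 < 1 - z := sub_pos.2 hz
  have hbx : 0 ≤ (1 - z) * (Real.exp (b * x) - 1) :=
    mul_nonneg hz0.le (sub_nonneg.2 (Real.one_le_exp (by positivity)))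
  have h2 : Real.exp x - 1 ≤ 2 * x := by
    have h := Real.abs_exp_sub_one_le (abs_le.2 ⟨by linarith, hx'⟩)
    rw [abs_of_pos hx] at h
    exact (le_abs_self _).trans h
  rw [one_div_sub_exp_div_eq hz hx, div_mul_eq_mul_div]
  refine div_le_div₀ (by positivity) (by linarith) (by positivity) ?_
  nlinarith

lemma integrableOn_one_div_sub_exp_div_mul_rpow {b z σ : ℝ} (hb : 0 ≤ b) (hb' : b < 1)
    (hz : z < 1) (hcond : (1 - z) * b ≤ 1) (hσ : -1 < σ) (hσ' : σ < 0) :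
    IntegrableOn (fun x : ℝ =>
      (1 / (1 - z) - Real.exp (b * x) / (Real.exp x - z)) * x ^ (σ - 1)) (Set.Ioi 0) := by
  have hmeas : Measurable (fun x : ℝ =>
      (1 / (1 - z) - Real.exp (b * x) / (Real.exp x - z)) * x ^ (σ - 1)) := by fun_prop
  have hnonneg {x : ℝ} (hx : 0 < x) := (one_div_sub_exp_div_pos hb hb' hz hcond hx).le
  rw [← Set.Ioc_union_Ioi_eq_Ioi zero_le_one]
  refine IntegrableOn.union ?_ ?_
  · have hdom : IntegrableOn (fun x : ℝ => 2 / (1 - z) ^ 2 * x ^ σ) (Set.Ioc 0 1) :=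
      ((intervalIntegrable_iff_integrableOn_Ioc_of_le zero_le_one).1
        (intervalIntegral.intervalIntegrable_rpow' hσ)).const_mul _
    refine hdom.mono' hmeas.aestronglyMeasurable ?_
    filter_upwards [ae_restrict_mem measurableSet_Ioc] with x hx
    have hx0 : 0 < x := hx.1
    rw [Real.norm_of_nonneg (mul_nonneg (hnonneg hx0) (by positivity))]
    calc _ ≤ 2 / (1 - z) ^ 2 * x * x ^ (σ - 1) :=
          mul_le_mul_of_nonneg_right (one_div_sub_exp_div_le_mul hb hz hx0 hx.2) (by positivity)
      _ = 2 / (1 - z) ^ 2 * x ^ σ := by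
          rw [Real.rpow_sub_one hx0.ne']
          field_simp
  · have hdom : IntegrableOn (fun x : ℝ => 1 / (1 - z) * x ^ (σ - 1)) (Set.Ioi 1) :=
      (integrableOn_Ioi_rpow_of_lt (by linarith) one_pos).const_mul _
    refine hdom.mono' hmeas.aestronglyMeasurable ?_
    filter_upwards [ae_restrict_mem measurableSet_Ioi] with x hx
    have hx0 : 0 < x := one_pos.trans hx
    rw [Real.norm_of_nonneg (mul_nonneg (hnonneg hx0) (by positivity))]
    exact mul_le_mul_of_nonneg_right (one_div_sub_exp_div_le_one_div hz hx0) (by positivity)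

theorem lerchPhi_integral_pos (a z σ : ℝ) (ha : 0 < a) (ha' : a ≤ 1)
    (hz : -1 ≤ z) (hz' : z < 1) (hcond : (1 - z) * (1 - a) ≤ 1)
    (hσ : -1 < σ) (hσ' : σ < 0) :
    0 < (1 / Real.Gamma σ) *
      ∫ x in Set.Ioi (0 : ℝ),
        (Real.exp ((1 - a) * x) / (Real.exp x - z) - 1 / (1 - z)) * x ^ (σ - 1) := by
  have hb : 0 ≤ 1 - a := by linarith
  have hb' : 1 - a < 1 := by linarith
  refine mul_pos_of_neg_of_neg (one_div_neg.2 (Gamma_neg_of_mem_Ioo hσ hσ')) ?_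
  rw [← neg_pos, ← integral_neg]
  simp only [← neg_mul, neg_sub]
  have hpos (x : ℝ) (hx : x ∈ Set.Ioi (0 : ℝ)) :
      0 < (1 / (1 - z) - Real.exp ((1 - a) * x) / (Real.exp x - z)) * x ^ (σ - 1) :=
    mul_pos (one_div_sub_exp_div_pos hb hb' hz' hcond hx) (Real.rpow_pos_of_pos hx _)
  rw [setIntegral_pos_iff_support_of_nonneg_ae
    ((ae_restrict_mem measurableSet_Ioi).mono fun x hx => (hpos x hx).le)
    (integrableOn_one_div_sub_exp_div_mul_rpow hb hb' hz' hcond hσ hσ'),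
    Set.inter_eq_self_of_subset_right fun x hx => Function.mem_support.2 (hpos x hx).ne']
  simp
end

section
/- Let 0 < a ≤ 1 and let z be a real number with -1 < z < 1 such that (1-z)(1-a) > 1. Then there exists σ ∈ (-1,0) such that ∑_{n=0}^∞ zⁿ (n+a)^{-σ} = 0 (the series converges absolutely since |z| < 1). -/
theorem summable_pow_mul_natCast_add {z : ℝ} (hz : |z| < 1) (a : ℝ) :
    Summable fun n : ℕ ↦ z ^ n * ((n : ℝ) + a) := by
  have h₁ := (hasSum_coe_mul_geometric_of_norm_lt_one (r := z) hz).summable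
  have h₂ := (summable_geometric_of_abs_lt_one hz).mul_right a
  exact (h₁.add h₂).congr fun n ↦ by ring

theorem tsum_pow_mul_natCast_add {z : ℝ} (hz : |z| < 1) (a : ℝ) :
    ∑' n : ℕ, z ^ n * ((n : ℝ) + a) = z / (1 - z) ^ 2 + a / (1 - z) := by
  have h₁ := hasSum_coe_mul_geometric_of_norm_lt_one (r := z) hz
  have h₂ := (hasSum_geometric_of_abs_lt_one hz).mul_right a
  rw [div_eq_inv_mul a, ← (h₁.add h₂).tsum_eq]
  exact tsum_congr fun n ↦ by ring

theorem continuousOn_tsum_pow_mul_rpow {a z : ℝ} (ha : 0 < a) (ha' : a ≤ 1) (hz : |z| < 1) :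
    ContinuousOn (fun s : ℝ ↦ ∑' n : ℕ, z ^ n * ((n : ℝ) + a) ^ s) (Set.Icc 0 1) := by
  have hz_abs : |(|z|)| < 1 := by rwa [abs_abs]
  refine continuousOn_tsum (fun n ↦ ?_) (summable_pow_mul_natCast_add hz_abs 1) ?_
  · have hn : (n : ℝ) + a ≠ 0 := by positivity
    exact (continuous_const.mul (Real.continuous_const_rpow hn)).continuousOn
  · intro n s hs
    have hn : 0 ≤ (n : ℝ) + a := by positivity
    rw [Real.norm_eq_abs, abs_mul, abs_pow, abs_of_nonneg (Real.rpow_nonneg hn s)]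
    gcongr
    calc ((n : ℝ) + a) ^ s ≤ ((n : ℝ) + 1) ^ s := by
          have := hs.1
          gcongr
      _ ≤ ((n : ℝ) + 1) ^ (1 : ℝ) :=
          Real.rpow_le_rpow_of_exponent_le (by linarith [Nat.cast_nonneg (α := ℝ) n]) hs.2
      _ = (n : ℝ) + 1 := Real.rpow_one _

theorem lerchPhi_has_zero_in_neg_one_zero (a z : ℝ) (ha : 0 < a) (ha' : a ≤ 1)
    (hz : -1 < z) (hz' : z < 1) (hcond : 1 < (1 - z) * (1 - a)) :
    ∃ σ : ℝ, -1 < σ ∧ σ < 0 ∧ ∑' n : ℕ, z ^ n * ((n : ℝ) + a) ^ (-σ) = 0 := by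
  have hz_abs : |z| < 1 := abs_lt.mpr ⟨hz, hz'⟩
  have hpos : 0 < 1 - z := by linarith
  have h₀ : 0 < ∑' n : ℕ, z ^ n * ((n : ℝ) + a) ^ (0 : ℝ) := by
    simp only [Real.rpow_zero, mul_one, tsum_geometric_of_abs_lt_one hz_abs]
    positivity
  have h₁ : ∑' n : ℕ, z ^ n * ((n : ℝ) + a) ^ (1 : ℝ) < 0 := by
    simp only [Real.rpow_one, tsum_pow_mul_natCast_add hz_abs]
    have hsum : z / (1 - z) ^ 2 + a / (1 - z) = (z + a * (1 - z)) / (1 - z) ^ 2 := by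
      field_simp
    rw [hsum]
    exact div_neg_of_neg_of_pos (by linarith) (by positivity)
  obtain ⟨s, ⟨hs₀, hs₁⟩, hs⟩ := intermediate_value_Ioo' zero_le_one
    (continuousOn_tsum_pow_mul_rpow ha ha' hz_abs) ⟨h₁, h₀⟩
  exact ⟨-s, by linarith, by linarith, by simpa only [neg_neg] using hs⟩
end

section
/- Let 0 < a ≤ 1 and define G(a,x) := e^{(1-a)x}/(e^x - 1) - 1/x - 1/2 + a for x > 0. Then G(a,x) < 0 for all x > 0 if and only if (3-√3)/6 ≤ a ≤ 1/2. -/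
/-- In the variables `t = x / 2` and `b = 1 - 2 * a`, the sign condition reads
`t * exp (b * t) < sinh t * (1 + b * t)`. -/
lemma G_neg_iff_mul_exp_lt_sinh (a : ℝ) {t : ℝ} (ht : 0 < t) :
    Real.exp ((1 - a) * (2 * t)) / (Real.exp (2 * t) - 1) - 1 / (2 * t) - 1 / 2 + a < 0 ↔
      t * Real.exp ((1 - 2 * a) * t) < Real.sinh t * (1 + (1 - 2 * a) * t) := by
  have hs : 0 < Real.sinh t := Real.sinh_pos_iff.2 ht
  have hden : Real.exp (2 * t) - 1 = Real.exp t * (2 * Real.sinh t) := by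
    rw [Real.sinh_eq, two_mul t, Real.exp_add, Real.exp_neg]
    field_simp
  have hnum : Real.exp ((1 - a) * (2 * t)) = Real.exp t * Real.exp ((1 - 2 * a) * t) := by
    rw [← Real.exp_add]
    ring_nf
  have key : Real.exp ((1 - a) * (2 * t)) / (Real.exp (2 * t) - 1) - 1 / (2 * t) - 1 / 2 + a =
      (t * Real.exp ((1 - 2 * a) * t) - Real.sinh t * (1 + (1 - 2 * a) * t)) /
        (2 * t * Real.sinh t) := by
    rw [hden, hnum, mul_div_mul_left _ _ (Real.exp_pos t).ne']
    field_simp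
    ring
  rw [key, div_neg_iff]
  have hp : 0 < 2 * t * Real.sinh t := by positivity
  constructor
  · rintro (⟨-, h⟩ | ⟨h, -⟩) <;> linarith
  · intro h
    exact Or.inr ⟨by linarith, hp⟩

lemma two_mul_add_one_le_three_pow (n : ℕ) : 2 * n + 1 ≤ 3 ^ n := by
  induction n with
  | zero => norm_num
  | succ n ih => rw [pow_succ]; omega

lemma mul_cosh_mul_lt_sinh {b t : ℝ} (hb : b ^ 2 ≤ 1 / 3) (ht : 0 < t) :
    t * Real.cosh (b * t) < Real.sinh t := by
  have hcoeff (n : ℕ) : (b ^ 2) ^ n * (2 * n + 1) ≤ 1 := by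
    have h₁ : (b ^ 2) ^ n ≤ (1 / 3) ^ n := pow_le_pow_left₀ (sq_nonneg b) hb n
    have h₂ : (2 * n + 1 : ℝ) ≤ 3 ^ n := by exact_mod_cast two_mul_add_one_le_three_pow n
    calc (b ^ 2) ^ n * (2 * n + 1) ≤ (1 / 3) ^ n * 3 ^ n := by gcongr
      _ = 1 := by rw [← mul_pow]; norm_num
  have hterm (n : ℕ) : t * ((b * t) ^ (2 * n) / (2 * n).factorial) =
      (b ^ 2) ^ n * (2 * n + 1) * (t ^ (2 * n + 1) / (2 * n + 1).factorial) := by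
    rw [Nat.factorial_succ]
    push_cast
    field_simp
    ring
  refine hasSum_lt (i := 2) (fun n => ?_) ?_ ((Real.hasSum_cosh (b * t)).mul_left t)
    (Real.hasSum_sinh t)
  · rw [hterm]
    exact mul_le_of_le_one_left (by positivity) (hcoeff n)
  · rw [hterm]
    refine mul_lt_of_lt_one_left (by positivity) ?_
    norm_num
    nlinarith [sq_nonneg b]

lemma sinh_mul_le_mul_sinh {b t : ℝ} (hb : 0 ≤ b) (hb' : b ≤ 1) (ht : 0 ≤ t) :
    Real.sinh (b * t) ≤ b * Real.sinh t := by
  refine hasSum_le (fun n => ?_) (Real.hasSum_sinh (b * t)) ((Real.hasSum_sinh t).mul_left b)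
  rw [mul_pow, mul_div_assoc]
  gcongr
  exact pow_le_of_le_one hb hb' (by omega)

lemma mul_exp_mul_lt_sinh_mul {b t : ℝ} (hb : 0 ≤ b) (hb' : b ^ 2 ≤ 1 / 3) (ht : 0 < t) :
    t * Real.exp (b * t) < Real.sinh t * (1 + b * t) := by
  have h₁ := mul_cosh_mul_lt_sinh hb' ht
  have h₂ := mul_le_mul_of_nonneg_left
    (sinh_mul_le_mul_sinh hb (by nlinarith : b ≤ 1) ht.le) ht.le
  rw [← Real.cosh_add_sinh]
  linarith

lemma sinh_le_add_pow_four {t : ℝ} (ht : 0 ≤ t) (ht' : t ≤ 1) :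
    Real.sinh t ≤ t + t ^ 3 / 6 + t ^ 4 := by
  have h₁ := Real.exp_bound (x := t) (by rwa [abs_of_nonneg ht]) (n := 4) (by norm_num)
  have h₂ := Real.exp_bound (x := -t) (by rwa [abs_neg, abs_of_nonneg ht]) (n := 4) (by norm_num)
  rw [abs_neg] at h₂
  rw [abs_of_nonneg ht] at h₁ h₂
  have h₁' := (abs_le.1 h₁).2
  have h₂' := (abs_le.1 h₂).1
  norm_num [Finset.sum_range_succ, Nat.factorial] at h₁' h₂'
  rw [Real.sinh_eq]
  have := pow_nonneg ht 4
  nlinarith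

lemma nonneg_of_forall_mul_exp_lt {b : ℝ}
    (h : ∀ t : ℝ, 0 < t → t * Real.exp (b * t) < Real.sinh t * (1 + b * t)) : 0 ≤ b := by
  by_contra! hb
  have ht : 0 < (-b)⁻¹ := inv_pos.2 (neg_pos.2 hb)
  have h₁ := h _ ht
  have h₂ : 1 + b * (-b)⁻¹ = 0 := by
    have := hb.ne
    field_simp
    norm_num
  rw [h₂, mul_zero] at h₁
  exact (mul_pos ht (Real.exp_pos _)).not_gt h₁

lemma sq_le_of_forall_mul_exp_lt {b : ℝ} (hb' : b ≤ 1)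
    (h : ∀ t : ℝ, 0 < t → t * Real.exp (b * t) < Real.sinh t * (1 + b * t)) :
    b ^ 2 ≤ 1 / 3 := by
  have hb : 0 ≤ b := nonneg_of_forall_mul_exp_lt h
  by_contra! hlt
  obtain ⟨t, ht⟩ : ∃ t : ℝ, t = (b ^ 2 - 1 / 3) / 6 := ⟨_, rfl⟩
  have ht₀ : 0 < t := by rw [ht]; linarith
  have ht₁ : t ≤ 1 := by rw [ht]; nlinarith
  have hbt : 0 ≤ b * t := by positivity
  have h₁ := mul_le_mul_of_nonneg_left (Real.quadratic_le_exp_of_nonneg hbt) ht₀.le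
  have h₂ := mul_le_mul_of_nonneg_right (sinh_le_add_pow_four ht₀.le ht₁)
    (by linarith : 0 ≤ 1 + b * t)
  have h₃ : t ^ 3 * (b ^ 2 / 2) < t ^ 3 * (1 / 6 + b * t / 6 + t + b * t * t) := by
    linarith [h t ht₀]
  have h₄ := lt_of_mul_lt_mul_left h₃ (by positivity)
  have h₅ : b * t ≤ t := mul_le_of_le_one_left ht₀.le hb'
  have h₆ : b * t * t ≤ t := by nlinarith
  linarith

theorem G_neg_iff (a : ℝ) (ha : 0 < a) (ha' : a ≤ 1) :
    (∀ x : ℝ, 0 < x →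
        Real.exp ((1 - a) * x) / (Real.exp x - 1) - 1 / x - 1 / 2 + a < 0) ↔
      (3 - Real.sqrt 3) / 6 ≤ a ∧ a ≤ 1 / 2 := by
  have h3 : Real.sqrt 3 ^ 2 = 3 := Real.sq_sqrt (by norm_num)
  have h3' : 0 ≤ Real.sqrt 3 := Real.sqrt_nonneg 3
  constructor
  · intro h
    have h' (t : ℝ) (ht : 0 < t) :
        t * Real.exp ((1 - 2 * a) * t) < Real.sinh t * (1 + (1 - 2 * a) * t) :=
      (G_neg_iff_mul_exp_lt_sinh a ht).1 (h (2 * t) (by positivity))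
    have h₁ := nonneg_of_forall_mul_exp_lt h'
    have h₂ := sq_le_of_forall_mul_exp_lt (by linarith) h'
    have h₃ : 1 - 2 * a ≤ Real.sqrt 3 / 3 := abs_le_of_sq_le_sq' (by nlinarith) (by positivity) |>.2
    constructor <;> linarith
  · rintro ⟨h₁, h₂⟩ x hx
    obtain ⟨t, rfl⟩ : ∃ t, x = 2 * t := ⟨x / 2, by ring⟩
    have ht : 0 < t := by linarith
    have h₃ : 1 - 2 * a ≤ Real.sqrt 3 / 3 := by linarith
    refine (G_neg_iff_mul_exp_lt_sinh a ht).2 (mul_exp_mul_lt_sinh_mul (by linarith) ?_ ht)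
    have h₄ := pow_le_pow_left₀ (by linarith) h₃ 2
    linarith [div_pow (Real.sqrt 3) 3 2]
end

section
/- Let 0 < a ≤ 1 and define G(a,x) := e^{(1-a)x}/(e^x - 1) - 1/x - 1/2 + a for x > 0. Then G(a,x) > 0 for all x > 0 if and only if (3+√3)/6 ≤ a ≤ 1. -/
/-- Substituting `x = 2 * y` and `a = (1 + u) / 2` turns positivity of `G(a, x)` into a bound
on `sinh`. -/
theorem G_pos_iff_sinh_mul_exp_lt (u : ℝ) {y : ℝ} (hy : 0 < y) :
    0 < Real.exp ((1 - (1 + u) / 2) * (2 * y)) / (Real.exp (2 * y) - 1) - 1 / (2 * y) - 1 / 2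
        + (1 + u) / 2 ↔
      Real.sinh y * (Real.exp (u * y) * (1 - u * y)) < y := by
  have hs : 0 < Real.sinh y := Real.sinh_pos_iff.2 hy
  have hE : Real.exp (2 * y) - 1 = 2 * Real.exp y * Real.sinh y := by
    have h : Real.exp y * Real.exp (-y) = 1 := by rw [← Real.exp_add]; simp
    have h2 : Real.exp (2 * y) = Real.exp y * Real.exp y := by rw [← Real.exp_add]; ring_nf
    rw [Real.sinh_eq, h2]
    linear_combination h
  have hN : Real.exp ((1 - (1 + u) / 2) * (2 * y)) = Real.exp y / Real.exp (u * y) := by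
    rw [← Real.exp_sub]; ring_nf
  have hP := Real.exp_pos y
  have hQ := Real.exp_pos (u * y)
  have key : Real.exp y / Real.exp (u * y) / (2 * Real.exp y * Real.sinh y) - 1 / (2 * y) - 1 / 2
        + (1 + u) / 2 =
      (y - Real.sinh y * (Real.exp (u * y) * (1 - u * y))) /
        (2 * y * Real.sinh y * Real.exp (u * y)) := by
    field_simp
    ring
  rw [hE, hN, key, div_pos_iff_of_pos_right (by positivity), sub_pos]

theorem six_pow_mul_factorial_le (n : ℕ) : 6 ^ n * n.factorial ≤ (2 * n + 1).factorial := by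
  induction n with
  | zero => simp
  | succ n ih =>
    rw [show 2 * (n + 1) + 1 = 2 * n + 1 + 1 + 1 by ring, Nat.factorial_succ (2 * n + 1 + 1),
      Nat.factorial_succ (2 * n + 1), Nat.factorial_succ n]
    calc 6 ^ (n + 1) * ((n + 1) * n.factorial) = 6 * (n + 1) * (6 ^ n * n.factorial) := by ring
      _ ≤ ((2 * n + 1 + 1 + 1) * (2 * n + 1 + 1)) * (2 * n + 1).factorial := by
        exact Nat.mul_le_mul (by nlinarith) ih
      _ = _ := by ring

theorem sinh_le_mul_exp_sq_div_six {y : ℝ} (hy : 0 ≤ y) :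
    Real.sinh y ≤ y * Real.exp (y ^ 2 / 6) := by
  have h := (NormedSpace.expSeries_div_hasSum_exp (y ^ 2 / 6)).mul_left y
  rw [← Real.exp_eq_exp_ℝ] at h
  refine hasSum_le (fun n => ?_) (Real.hasSum_sinh y) h
  have hn : (6 : ℝ) ^ n * n.factorial ≤ (2 * n + 1).factorial := by
    exact_mod_cast six_pow_mul_factorial_le n
  calc y ^ (2 * n + 1) / (2 * n + 1).factorial
      ≤ y ^ (2 * n + 1) / (6 ^ n * n.factorial) := by gcongr
    _ = y * ((y ^ 2 / 6) ^ n / n.factorial) := by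
      rw [div_pow, ← pow_mul, pow_succ]
      field_simp

theorem add_cube_div_six_le_sinh {y : ℝ} (hy : 0 ≤ y) : y + y ^ 3 / 6 ≤ Real.sinh y := by
  have h := sum_le_hasSum (Finset.range 2) (fun n _ => by positivity) (Real.hasSum_sinh y)
  norm_num [Finset.sum_range_succ, Nat.factorial] at h
  exact h

theorem exp_mul_one_sub_lt_exp_neg_sq_div_two {v : ℝ} (h0 : 0 < v) (h1 : v < 1) :
    Real.exp v * (1 - v) < Real.exp (-(v ^ 2 / 2)) := by
  have h := sum_le_hasSum (Finset.range 3) (fun n _ => by positivity)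
    (Real.hasSum_pow_div_log_of_abs_lt_one (abs_lt.2 ⟨by linarith, h1⟩))
  norm_num [Finset.sum_range_succ] at h
  rw [← Real.exp_log (sub_pos.2 h1), ← Real.exp_add, Real.exp_lt_exp]
  have : 0 < v ^ 3 := by positivity
  linarith

theorem sinh_mul_exp_lt {u y : ℝ} (hu : 0 < u) (hu' : 1 ≤ 3 * u ^ 2) (hy : 0 < y) :
    Real.sinh y * (Real.exp (u * y) * (1 - u * y)) < y := by
  have hs : 0 < Real.sinh y := Real.sinh_pos_iff.2 hy
  rcases lt_or_ge (u * y) 1 with h | h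
  · calc Real.sinh y * (Real.exp (u * y) * (1 - u * y))
        < Real.sinh y * Real.exp (-((u * y) ^ 2 / 2)) := by
          gcongr
          exact exp_mul_one_sub_lt_exp_neg_sq_div_two (by positivity) h
      _ ≤ y * Real.exp (y ^ 2 / 6) * Real.exp (-((u * y) ^ 2 / 2)) := by
          gcongr
          exact sinh_le_mul_exp_sq_div_six hy.le
      _ = y * Real.exp (y ^ 2 / 6 - (u * y) ^ 2 / 2) := by
          rw [mul_assoc, ← Real.exp_add, sub_eq_add_neg]
      _ ≤ y * 1 := by
          gcongr
          rw [Real.exp_le_one_iff]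
          nlinarith [sq_nonneg y]
      _ = y := mul_one y
  · have : Real.exp (u * y) * (1 - u * y) ≤ 0 :=
      mul_nonpos_of_nonneg_of_nonpos (Real.exp_pos _).le (by linarith)
    nlinarith

theorem exists_le_sinh_mul_exp {u : ℝ} (hu : 0 ≤ u) (hu' : 3 * u ^ 2 < 1) :
    ∃ y > 0, y ≤ Real.sinh y * (Real.exp (u * y) * (1 - u * y)) := by
  obtain ⟨y, hy⟩ : ∃ y, y = (1 - 3 * u ^ 2) / 4 := ⟨_, rfl⟩
  have hy0 : 0 < y := by linarith
  have hy1 : y ≤ 1 := by nlinarith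
  have hu1 : u ≤ 1 := by nlinarith
  have hv0 : 0 ≤ u * y := by positivity
  have hv1 : u * y ≤ 1 := mul_le_one₀ hu1 hy0.le hy1
  have hu2 : u ^ 2 ≤ 1 := pow_le_one₀ hu hu1
  have hu3 : u ^ 3 ≤ 1 := pow_le_one₀ hu hu1
  have hlow : 0 ≤ (1 - u * y) * (1 + u * y + (u * y) ^ 2 / 2) :=
    mul_nonneg (by linarith) (by positivity)
  refine ⟨y, hy0, ?_⟩
  have hpoly : 1 ≤ (1 + y ^ 2 / 6) * ((1 - u * y) * (1 + u * y + (u * y) ^ 2 / 2)) := by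
    have e1 : u ^ 3 * y ≤ 1 * y := by gcongr
    have e2 : u ^ 2 * y ^ 2 ≤ 1 * y := mul_le_mul hu2 (by nlinarith) (by positivity) (by norm_num)
    have e3 : u ^ 3 * y ^ 3 ≤ 1 * y :=
      mul_le_mul hu3 (pow_le_of_le_one hy0.le hy1 (by norm_num)) (by positivity) (by norm_num)
    have hc : 0 ≤ (1 - 3 * u ^ 2) / 6 - u ^ 3 * y / 2 - u ^ 2 * y ^ 2 / 12 - u ^ 3 * y ^ 3 / 12 := by
      linarith
    nlinarith [mul_nonneg (sq_nonneg y) hc]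
  calc y = y * 1 := (mul_one y).symm
    _ ≤ y * ((1 + y ^ 2 / 6) * ((1 - u * y) * (1 + u * y + (u * y) ^ 2 / 2))) := by gcongr
    _ = (y + y ^ 3 / 6) * ((1 + u * y + (u * y) ^ 2 / 2) * (1 - u * y)) := by ring
    _ ≤ Real.sinh y * (Real.exp (u * y) * (1 - u * y)) := by
      have : 0 ≤ 1 - u * y := by linarith
      gcongr
      · exact add_cube_div_six_le_sinh hy0.le
      · exact Real.quadratic_le_exp_of_nonneg hv0

theorem exists_G_nonpos_of_lt_half {a : ℝ} (ha : 0 < a) (ha' : a < 1 / 2) :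
    ∃ x > 0, Real.exp ((1 - a) * x) / (Real.exp x - 1) - 1 / x - 1 / 2 + a ≤ 0 := by
  have hd : 0 < 1 / 2 - a := by linarith
  obtain ⟨x, hx⟩ : ∃ x, x = 1 + 2 / (a * (1 / 2 - a)) := ⟨_, rfl⟩
  have hx1 : 1 ≤ x := by rw [hx]; linarith [show 0 < 2 / (a * (1 / 2 - a)) by positivity]
  refine ⟨x, by linarith, ?_⟩
  have hE : 2 ≤ Real.exp x := by linarith [Real.add_one_le_exp x]
  have hA : 2 / (1 / 2 - a) ≤ Real.exp (a * x) := by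
    have : a * x = a + 2 / (1 / 2 - a) := by rw [hx]; field_simp
    linarith [Real.add_one_le_exp (a * x)]
  have hM : Real.exp ((1 - a) * x) * Real.exp (a * x) = Real.exp x := by
    rw [← Real.exp_add]; ring_nf
  rw [div_le_iff₀ hd] at hA
  have : Real.exp ((1 - a) * x) / (Real.exp x - 1) ≤ 1 / 2 - a := by
    rw [div_le_iff₀ (by linarith)]
    have := mul_le_mul_of_nonneg_left hA (Real.exp_pos ((1 - a) * x)).le
    rw [← mul_assoc, hM] at this
    nlinarith
  linarith [show 0 < 1 / x by positivity]

theorem G_pos_iff (a : ℝ) (ha : 0 < a) (ha' : a ≤ 1) :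
    (∀ x : ℝ, 0 < x →
        0 < Real.exp ((1 - a) * x) / (Real.exp x - 1) - 1 / x - 1 / 2 + a) ↔
      (3 + Real.sqrt 3) / 6 ≤ a ∧ a ≤ 1 := by
  obtain ⟨u, rfl⟩ : ∃ u, a = (1 + u) / 2 := ⟨2 * a - 1, by ring⟩
  have hs : 0 < Real.sqrt 3 := by positivity
  have hs2 : Real.sqrt 3 ^ 2 = 3 := Real.sq_sqrt (by norm_num)
  constructor
  · refine fun h => ⟨?_, ha'⟩
    by_contra! hlt
    rcases lt_or_ge u 0 with hu | hu
    · obtain ⟨x, hx, hle⟩ := exists_G_nonpos_of_lt_half ha (by linarith)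
      exact (h x hx).not_ge hle
    · obtain ⟨y, hy, hle⟩ := exists_le_sinh_mul_exp hu (by nlinarith)
      exact ((G_pos_iff_sinh_mul_exp_lt u hy).1 (h (2 * y) (by linarith))).not_ge hle
  · rintro ⟨h, -⟩ x hx
    obtain ⟨y, rfl⟩ : ∃ y, x = 2 * y := ⟨x / 2, by ring⟩
    have hy : 0 < y := by linarith
    exact (G_pos_iff_sinh_mul_exp_lt u hy).2 (sinh_mul_exp_lt (by linarith) (by nlinarith) hy)
end

section
/- Let 0 < a ≤ 1. Set g(a,x) := x e^{(1-a)x} - e^x + 1 - (1/2 - a) x (e^x - 1), so that g''(a,x) = ((1-a)² x + 2(1-a)) e^{(1-a)x} - e^x - (1/2 - a)(x e^x + 2 e^x) (second derivative in x). If (3-√3)/6 ≤ a ≤ 1/2 then g''(a,x) < 0 for all x > 0, and if (3+√3)/6 ≤ a ≤ 1 then g''(a,x) > 0 for all x > 0. -/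
/-- The lower Padé bound `(2 - t) / (2 + t) ≤ exp (-t)` for `0 ≤ t`, without division. -/
lemma two_sub_le_two_add_mul_exp_neg {t : ℝ} (ht : 0 ≤ t) :
    2 - t ≤ (2 + t) * Real.exp (-t) := by
  have hd (s : ℝ) : HasDerivAt (fun s : ℝ => (2 + s) - (2 - s) * Real.exp s)
      (1 - (1 - s) * Real.exp s) s := by
    have h := ((hasDerivAt_id s).const_add 2).sub
      (((hasDerivAt_id s).const_sub 2).mul (Real.hasDerivAt_exp s))
    refine h.congr_deriv ?_
    simp only [id]
    ring
  have hmono : Monotone (fun s : ℝ => (2 + s) - (2 - s) * Real.exp s) := by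
    refine monotone_of_hasDerivAt_nonneg hd fun s => ?_
    have h := mul_le_mul_of_nonneg_right (Real.one_sub_le_exp_neg s) (Real.exp_pos s).le
    rw [← Real.exp_add, neg_add_cancel, Real.exp_zero] at h
    simpa using h
  have h0 : (2 - t) * Real.exp t ≤ 2 + t := by
    have := hmono ht
    norm_num at this
    linarith
  rw [Real.exp_neg, ← div_eq_mul_inv]
  exact (le_div_iff₀ (Real.exp_pos t)).2 h0

theorem g_second_deriv_sign (a : ℝ) (ha : 0 < a) (ha' : a ≤ 1) :
    (∀ x : ℝ,
      deriv (deriv (fun y : ℝ =>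
          y * Real.exp ((1 - a) * y) - Real.exp y + 1
            - (1 / 2 - a) * y * (Real.exp y - 1))) x =
        ((1 - a) ^ 2 * x + 2 * (1 - a)) * Real.exp ((1 - a) * x) - Real.exp x
          - (1 / 2 - a) * (x * Real.exp x + 2 * Real.exp x)) ∧
    ((3 - Real.sqrt 3) / 6 ≤ a → a ≤ 1 / 2 → ∀ x : ℝ, 0 < x →
      ((1 - a) ^ 2 * x + 2 * (1 - a)) * Real.exp ((1 - a) * x) - Real.exp x
        - (1 / 2 - a) * (x * Real.exp x + 2 * Real.exp x) < 0) ∧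
    ((3 + Real.sqrt 3) / 6 ≤ a → a ≤ 1 → ∀ x : ℝ, 0 < x →
      0 < ((1 - a) ^ 2 * x + 2 * (1 - a)) * Real.exp ((1 - a) * x) - Real.exp x
        - (1 / 2 - a) * (x * Real.exp x + 2 * Real.exp x)) := by
  have hs : Real.sqrt 3 ^ 2 = 3 := Real.sq_sqrt (by norm_num)
  have hs0 : 0 ≤ Real.sqrt 3 := Real.sqrt_nonneg 3
  have hs1 : 1 < Real.sqrt 3 := by nlinarith
  refine ⟨fun x => ?_, fun h1 h2 x hx => ?_, fun h1 _ x hx => ?_⟩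
  · have hE (y : ℝ) : HasDerivAt (fun y : ℝ => Real.exp ((1 - a) * y))
        (Real.exp ((1 - a) * y) * (1 - a)) y := by
      simpa using ((hasDerivAt_id y).const_mul (1 - a)).exp
    have hg : deriv (fun y : ℝ => y * Real.exp ((1 - a) * y) - Real.exp y + 1
          - (1 / 2 - a) * y * (Real.exp y - 1)) =
        fun y => (1 + (1 - a) * y) * Real.exp ((1 - a) * y) - Real.exp y
          - (1 / 2 - a) * ((1 + y) * Real.exp y - 1) := by
      funext y
      have h := ((((hasDerivAt_id y).mul (hE y)).sub (Real.hasDerivAt_exp y)).add_const 1).sub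
        (((hasDerivAt_id y).const_mul (1 / 2 - a)).mul ((Real.hasDerivAt_exp y).sub_const 1))
      refine HasDerivAt.deriv (h.congr_deriv ?_)
      simp only [id]
      ring
    rw [hg]
    have h := (((((hasDerivAt_id x).const_mul (1 - a)).const_add 1).mul (hE x)).sub
      (Real.hasDerivAt_exp x)).sub
        (((((hasDerivAt_id x).const_add 1).mul (Real.hasDerivAt_exp x)).sub_const 1).const_mul
          (1 / 2 - a))
    refine HasDerivAt.deriv (h.congr_deriv ?_)
    simp only [id]
    ring
  · have hB : 3 * a ^ 2 - 3 * a + 1 / 2 ≤ 0 := by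
      nlinarith [mul_nonneg (sub_nonneg.2 h1) (by linarith : 0 ≤ (3 + Real.sqrt 3) / 6 - a)]
    have hsplit : Real.exp x = Real.exp ((1 - a) * x) * Real.exp (a * x) := by
      rw [← Real.exp_add]
      ring_nf
    have hq := Real.quadratic_le_exp_of_nonneg (mul_pos ha hx).le
    have hc : 0 ≤ (1 / 2 - a) * x + 2 * (1 - a) := by
      have := mul_nonneg (sub_nonneg.2 h2) hx.le
      linarith
    have hkey : (1 - a) ^ 2 * x + 2 * (1 - a) <
        ((1 / 2 - a) * x + 2 * (1 - a)) * Real.exp (a * x) := by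
      refine lt_of_lt_of_le ?_ (mul_le_mul_of_nonneg_left hq hc)
      have p1 : 0 ≤ -(3 * a ^ 2 - 3 * a + 1 / 2) * x := mul_nonneg (by linarith) hx.le
      have p2 : 0 ≤ (1 / 2 - a) * (a * x ^ 2 + a ^ 2 * x ^ 3 / 2) :=
        mul_nonneg (by linarith) (by positivity)
      have p3 : 0 < (1 - a) * (a ^ 2 * x ^ 2) := mul_pos (by linarith) (by positivity)
      linarith
    have := mul_lt_mul_of_pos_left hkey (Real.exp_pos ((1 - a) * x))
    rw [hsplit]
    linarith
  · have hB : 0 ≤ 3 * a ^ 2 - 3 * a + 1 / 2 := by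
      nlinarith [mul_nonneg (sub_nonneg.2 h1) (by linarith : 0 ≤ a - (3 - Real.sqrt 3) / 6)]
    have hsplit : Real.exp ((1 - a) * x) = Real.exp x * Real.exp (-(a * x)) := by
      rw [← Real.exp_add]
      ring_nf
    have hax : 0 < a * x := mul_pos ha hx
    have hc : 0 ≤ (1 - a) ^ 2 * x + 2 * (1 - a) := by
      have := mul_nonneg (sq_nonneg (1 - a)) hx.le
      linarith
    have hkey : 2 * (1 - a) - (a - 1 / 2) * x <
        ((1 - a) ^ 2 * x + 2 * (1 - a)) * Real.exp (-(a * x)) := by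
      have hp := mul_le_mul_of_nonneg_left (two_sub_le_two_add_mul_exp_neg hax.le) hc
      have p1 : 0 ≤ (3 * a ^ 2 - 3 * a + 1 / 2) * x := mul_nonneg hB hx.le
      have p2 : 0 < (a - 1 / 2 - (1 - a) ^ 2) * (a * x ^ 2) :=
        mul_pos (by nlinarith) (by positivity)
      refine lt_of_mul_lt_mul_left ?_ (by linarith : 0 ≤ 2 + a * x)
      linarith
    have := mul_lt_mul_of_pos_left hkey (Real.exp_pos x)
    rw [hsplit]
    linarith
end

section
/- Let 0 < a ≤ 1 and let s ∈ ℂ with -1 < Re(s) < 0. Then Γ(s) · ζ(s,a) = ∫₀^∞ ( e^{(1-a)x}/(e^x - 1) - 1/x - 1/2 + a ) x^{s-1} dx, where the integral is a complex-valued integral over (0,∞) and x^{s-1} = exp((s-1) log x). -/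
open HurwitzZeta Complex MeasureTheory

open Set Filter Topology Asymptotics

lemma exp_kernel_sub_isBigO (b : ℝ) :
    (fun x : ℝ ↦ Real.exp (b * x) / (Real.exp x - 1) - 1 / x - (b - 1 / 2)) =O[𝓝[>] 0]
      (fun x ↦ x) := by
  have h3 : (fun x : ℝ ↦ Real.exp x - (1 + x + x ^ 2 / 2)) =O[𝓝[>] 0] (fun x ↦ x ^ 3) := by
    refine ((Real.exp_sub_sum_range_isBigO_pow 3).mono nhdsWithin_le_nhds).congr_left fun x ↦ ?_
    simp [Finset.sum_range_succ]
  have h2 : (fun x : ℝ ↦ Real.exp (b * x) - (1 + b * x)) =O[𝓝[>] 0] (fun x ↦ x ^ 2) := by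
    have ht : Tendsto (fun x : ℝ ↦ b * x) (𝓝[>] 0) (𝓝 0) := by
      have : Continuous (fun x : ℝ ↦ b * x) := by fun_prop
      simpa using (this.tendsto 0).mono_left nhdsWithin_le_nhds
    have h := (Real.exp_sub_sum_range_isBigO_pow 2).comp_tendsto ht
    refine (h.congr_left (f₂ := fun x : ℝ ↦ Real.exp (b * x) - (1 + b * x)) fun x ↦ ?_).trans ?_
    · simp [Finset.sum_range_succ]
    · refine (isBigO_const_mul_self (b ^ 2) (fun x : ℝ ↦ x ^ 2) _).congr_left fun x ↦ ?_
      simp [mul_pow]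
  have hnum : (fun x : ℝ ↦ x * (Real.exp (b * x) - (1 + b * x))
      - (1 + (b - 1 / 2) * x) * (Real.exp x - (1 + x + x ^ 2 / 2)) - (b - 1 / 2) / 2 * x ^ 3)
      =O[𝓝[>] 0] (fun x ↦ x ^ 3) := by
    refine (IsBigO.sub ?_ ?_).sub (isBigO_const_mul_self _ _ _)
    · exact ((isBigO_refl (fun x : ℝ ↦ x) _).mul h2).congr_right fun x ↦ by ring
    · have h1 : (fun x : ℝ ↦ 1 + (b - 1 / 2) * x) =O[𝓝[>] 0] (fun _ ↦ (1 : ℝ)) := by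
        have : Continuous (fun x : ℝ ↦ 1 + (b - 1 / 2) * x) := by fun_prop
        exact ((this.tendsto 0).mono_left nhdsWithin_le_nhds).isBigO_one ℝ
      exact (h1.mul h3).congr_right fun x ↦ by ring
  have hden : (fun x : ℝ ↦ (x * (Real.exp x - 1))⁻¹) =O[𝓝[>] 0] (fun x ↦ (x ^ 2)⁻¹) := by
    refine IsBigO.of_bound 1 ?_
    filter_upwards [self_mem_nhdsWithin] with x (hx : 0 < x)
    have := Real.add_one_le_exp x
    have : 0 ≤ Real.exp x - 1 := by linarith
    rw [one_mul, Real.norm_of_nonneg (by positivity), Real.norm_of_nonneg (by positivity)]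
    gcongr
    nlinarith
  refine (hnum.mul hden).congr' ?_ ?_
  · filter_upwards [self_mem_nhdsWithin] with x (hx : 0 < x)
    have : Real.exp x - 1 ≠ 0 := by linarith [Real.add_one_le_exp x]
    field_simp
    ring
  · filter_upwards [self_mem_nhdsWithin] with x (hx : 0 < x)
    field_simp

lemma exp_kernel_isBigO_atTop (a : ℝ) :
    (fun x : ℝ ↦ Real.exp ((1 - a) * x) / (Real.exp x - 1)) =O[atTop]
      (fun x ↦ Real.exp (-a * x)) := by
  refine IsBigO.of_bound 2 ?_
  filter_upwards [eventually_ge_atTop 1] with x hx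
  have := Real.add_one_le_exp x
  have h0 : 0 < Real.exp x - 1 := by linarith
  rw [Real.norm_of_nonneg (by positivity), Real.norm_of_nonneg (by positivity), div_le_iff₀ h0,
    show (1 - a) * x = -a * x + x by ring, Real.exp_add]
  nlinarith [Real.exp_pos (-a * x)]

lemma continuousOn_exp_kernel (b : ℝ) :
    ContinuousOn (fun x : ℝ ↦ Real.exp (b * x) / (Real.exp x - 1)) (Ioi 0) := by
  refine ContinuousOn.div (by fun_prop) (by fun_prop) fun x (hx : 0 < x) ↦ ?_
  linarith [Real.add_one_le_exp x]

lemma mellin_exp_kernel {a : ℝ} (ha : 0 < a) (ha' : a ≤ 1) {s : ℂ} (hs : 1 < s.re) :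
    mellin (fun x : ℝ ↦ ((Real.exp ((1 - a) * x) / (Real.exp x - 1) : ℝ) : ℂ)) s =
      Gamma s * hurwitzZeta (a : UnitAddCircle) s := by
  have hz := hasSum_hurwitzZeta_of_one_lt_re ⟨ha.le, ha'⟩ hs
  refine (hasSum_mellin (a := fun _ : ℕ ↦ (1 : ℂ)) (p := fun n ↦ n + a) ?_ (by linarith)
    ?_ ?_).unique ((hz.mul_left (Gamma s)).congr_fun ?_)
  · exact fun n ↦ .inr (by positivity)
  · intro t (ht : 0 < t)
    have hr : Real.exp (-t) < 1 := by simpa using ht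
    have hg := (hasSum_geometric_of_lt_one (Real.exp_pos _).le hr).mul_left (Real.exp (-a * t))
    have hv : Real.exp (-a * t) * (1 - Real.exp (-t))⁻¹ =
        Real.exp ((1 - a) * t) / (Real.exp t - 1) := by
      rw [show (1 - a) * t = -a * t + t by ring, Real.exp_add, Real.exp_neg t]
      have : Real.exp t - 1 ≠ 0 := by linarith [Real.add_one_le_exp t]
      have : 1 - (Real.exp t)⁻¹ ≠ 0 := by
        rw [← Real.exp_neg]; linarith
      field_simp
    rw [hv] at hg
    refine (hasSum_ofReal.mpr hg).congr_fun fun n ↦ ?_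
    rw [one_mul, ← Real.exp_nat_mul, ← Real.exp_add]
    congr 2
    ring
  · refine hz.summable.norm.congr fun n ↦ ?_
    have : 0 < n + a := by positivity
    rw [norm_div, norm_one, show (n + a : ℂ) = ((n + a : ℝ) : ℂ) by push_cast; rfl,
      norm_cpow_eq_rpow_re_of_pos this]
  · intro n
    simp [div_eq_mul_inv]

lemma locallyIntegrableOn_indicator {E : Type*} [NormedAddCommGroup E] {f : ℝ → E} {t s : Set ℝ}
    (hf : LocallyIntegrableOn f t) (hs : MeasurableSet s) :
    LocallyIntegrableOn (s.indicator f) t := fun x hx ↦ by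
  obtain ⟨u, hu, hi⟩ := hf x hx
  exact ⟨u, hu, hi.indicator hs⟩

/-- The kernel `exp ((1 - a) x) / (exp x - 1)` minus its polar and constant parts at `0`, the latter
being cut off to `(0, 1]`. -/
noncomputable def truncatedKernel (a : ℝ) (x : ℝ) : ℂ :=
  ((Real.exp ((1 - a) * x) / (Real.exp x - 1) : ℝ) : ℂ) -
    (Ioc 0 1).indicator (fun t : ℝ ↦ (t : ℂ) ^ (-1 : ℂ) + (1 / 2 - a)) x

lemma locallyIntegrableOn_truncatedKernel (a : ℝ) :
    LocallyIntegrableOn (truncatedKernel a) (Ioi 0) := by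
  refine LocallyIntegrableOn.sub ?_ (locallyIntegrableOn_indicator ?_ measurableSet_Ioc)
  · exact (continuous_ofReal.comp_continuousOn
      (continuousOn_exp_kernel (1 - a))).locallyIntegrableOn measurableSet_Ioi
  · refine ContinuousOn.locallyIntegrableOn (fun x (hx : 0 < x) ↦ ?_) measurableSet_Ioi
    refine ContinuousAt.continuousWithinAt (ContinuousAt.add ?_ continuousAt_const)
    exact continuousAt_ofReal_cpow_const x _ (.inr hx.ne')

lemma truncatedKernel_isBigO_atTop (a : ℝ) :
    truncatedKernel a =O[atTop] (fun x ↦ Real.exp (-a * x)) := by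
  refine (isBigO_ofReal_left.mpr (exp_kernel_isBigO_atTop a)).congr' ?_ .rfl
  filter_upwards [eventually_gt_atTop 1] with x hx
  simp [truncatedKernel, hx.not_ge]

lemma truncatedKernel_isBigO_zero (a : ℝ) :
    truncatedKernel a =O[𝓝[>] 0] (fun x ↦ x ^ (-(-1 : ℝ))) := by
  refine (isBigO_ofReal_left.mpr (exp_kernel_sub_isBigO (1 - a))).congr' ?_ ?_
  · filter_upwards [Ioc_mem_nhdsGT zero_lt_one] with x hx
    rw [truncatedKernel, indicator_of_mem hx, cpow_neg_one]
    push_cast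
    ring
  · exact .of_forall fun x ↦ by simp

lemma mellinConvergent_truncatedKernel {a : ℝ} (ha : 0 < a) {s : ℂ} (hs : -1 < s.re) :
    MellinConvergent (truncatedKernel a) s :=
  mellinConvergent_of_isBigO_rpow_exp ha (locallyIntegrableOn_truncatedKernel a)
    (truncatedKernel_isBigO_atTop a) (truncatedKernel_isBigO_zero a) hs

lemma differentiableAt_mellin_truncatedKernel {a : ℝ} (ha : 0 < a) {s : ℂ} (hs : -1 < s.re) :
    DifferentiableAt ℂ (mellin (truncatedKernel a)) s :=
  mellin_differentiableAt_of_isBigO_rpow_exp ha (locallyIntegrableOn_truncatedKernel a)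
    (truncatedKernel_isBigO_atTop a) (truncatedKernel_isBigO_zero a) hs

lemma mellin_truncatedKernel_of_one_lt_re {a : ℝ} (ha : 0 < a) (ha' : a ≤ 1) {s : ℂ}
    (hs : 1 < s.re) :
    mellin (truncatedKernel a) s =
      Gamma s * hurwitzZeta (a : UnitAddCircle) s - (1 / (s - 1) + (1 / 2 - a) * (1 / s)) := by
  have h1 := hasMellin_cpow_Ioc (-1) (s := s) (by simpa using hs)
  have h0 := hasMellin_one_Ioc (s := s) (by linarith)
  have h2 := hasMellin_const_smul h0.1 (1 / 2 - a : ℂ)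
  have h3 := hasMellin_add h1.1 h2.1
  have h4 := hasMellin_add (mellinConvergent_truncatedKernel ha (s := s) (by linarith)) h3.1
  have h5 := h4.2
  rw [h3.2, h1.2, h2.2, h0.2, smul_eq_mul] at h5
  rw [← mellin_exp_kernel ha ha' hs, sub_eq_add_neg s, eq_sub_iff_add_eq, ← h5]
  congr 1
  ext x
  by_cases hx : x ∈ Ioc (0 : ℝ) 1 <;> simp [truncatedKernel, hx]

lemma differentiable_hurwitzZeta_sub_pole (a : UnitAddCircle) :
    Differentiable ℂ (fun s ↦ hurwitzZeta a s - 1 / (s - 1) / Gammaℝ s) := fun s ↦ by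
  rcases eq_or_ne s 1 with rfl | hs
  · exact differentiableAt_hurwitzZeta_sub_one_div a
  · refine (differentiableAt_hurwitzZeta a hs).sub ?_
    simp_rw [div_eq_mul_inv]
    refine DifferentiableAt.mul ?_ (differentiable_Gammaℝ_inv s)
    exact (differentiableAt_const _).mul
      ((differentiableAt_id.sub_const 1).inv (sub_ne_zero.mpr hs))

lemma mellin_truncatedKernel {a : ℝ} (ha : 0 < a) (ha' : a ≤ 1) {s : ℂ}
    (hs : -1 < s.re) (h0 : s ≠ 0) (h1 : s ≠ 1) :
    mellin (truncatedKernel a) s =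
      Gamma s * hurwitzZeta (a : UnitAddCircle) s - (1 / (s - 1) + (1 / 2 - a) * (1 / s)) := by
  let U : Set ℂ := {z | -1 < z.re}
  have hU : IsOpen U := isOpen_lt continuous_const continuous_re
  have hUc : IsPreconnected U := (convex_halfSpace_re_gt (-1)).isPreconnected
  let Φ : ℂ → ℂ := fun z ↦ z * (z - 1) * mellin (truncatedKernel a) z
  let Ψ : ℂ → ℂ := fun z ↦ Gamma (z + 1) * ((z - 1) *
    (hurwitzZeta (a : UnitAddCircle) z - 1 / (z - 1) / Gammaℝ z) + (Gammaℝ z)⁻¹) -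
      (z + (1 / 2 - a) * (z - 1))
  have hΨ {z : ℂ} (hz0 : z ≠ 0) (hz1 : z ≠ 1) : Ψ z = z * (z - 1) *
      (Gamma z * hurwitzZeta (a : UnitAddCircle) z - (1 / (z - 1) + (1 / 2 - a) * (1 / z))) := by
    have := sub_ne_zero.mpr hz1
    have key : (z - 1) * (hurwitzZeta (a : UnitAddCircle) z - 1 / (z - 1) / Gammaℝ z)
        + (Gammaℝ z)⁻¹ = (z - 1) * hurwitzZeta (a : UnitAddCircle) z := by
      rw [div_eq_mul_inv _ (Gammaℝ z)]
      generalize (Gammaℝ z)⁻¹ = g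
      field_simp
      ring
    simp only [Ψ]
    rw [key, Gamma_add_one z hz0]
    field_simp
  have hΦd : AnalyticOnNhd ℂ Φ U := by
    refine DifferentiableOn.analyticOnNhd (fun z hz ↦ ?_) hU
    refine (DifferentiableAt.mul ?_
      (differentiableAt_mellin_truncatedKernel ha hz)).differentiableWithinAt
    fun_prop
  have hΨd : AnalyticOnNhd ℂ Ψ U := by
    refine DifferentiableOn.analyticOnNhd (fun z (hz : -1 < z.re) ↦ ?_) hU
    have hG : DifferentiableAt ℂ (fun z ↦ Gamma (z + 1)) z := by
      refine DifferentiableAt.comp z (differentiableAt_Gamma _ fun m h ↦ ?_) (by fun_prop)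
      have := congr_arg re h
      simp only [add_re, one_re, neg_re, natCast_re] at this
      have : (0 : ℝ) ≤ m := m.cast_nonneg
      linarith
    have hD := differentiable_hurwitzZeta_sub_pole (a : UnitAddCircle) z
    have hi := differentiable_Gammaℝ_inv z
    refine DifferentiableAt.differentiableWithinAt ((hG.mul (DifferentiableAt.add
      (DifferentiableAt.mul ?_ hD) hi)).sub ?_) <;> fun_prop
  have heq : Φ =ᶠ[𝓝 2] Ψ := by
    filter_upwards [(isOpen_lt continuous_const continuous_re).mem_nhds
      (show (1 : ℝ) < (2 : ℂ).re by simp)] with z (hz : 1 < z.re)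
    have hz0 : z ≠ 0 := by rintro rfl; norm_num at hz
    have hz1 : z ≠ 1 := by rintro rfl; norm_num at hz
    rw [hΨ hz0 hz1, ← mellin_truncatedKernel_of_one_lt_re ha ha' hz]
  have h := hΦd.eqOn_of_preconnected_of_eventuallyEq hΨd hUc
    (show (-1 : ℝ) < (2 : ℂ).re by simp; norm_num) heq hs
  rw [hΨ h0 h1] at h
  exact mul_left_cancel₀ (mul_ne_zero h0 (sub_ne_zero.mpr h1)) h

lemma hasMellin_cpow_Ioi (b : ℂ) {s : ℂ} (hs : s.re + b.re < 0) :
    HasMellin (indicator (Ioi 1) (fun t ↦ t ^ b : ℝ → ℂ)) s (-(1 / (s + b))) := by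
  have hre : (s - 1 + b).re < -1 := by
    simp only [add_re, sub_re, one_re]
    linarith
  have hcongr : EqOn (fun t : ℝ ↦ (t : ℂ) ^ (s - 1 + b)) (fun t : ℝ ↦ (t : ℂ) ^ (s - 1) * t ^ b)
      (Ioi 1) := fun t (ht : 1 < t) ↦
    cpow_add _ _ (ofReal_ne_zero.mpr (by linarith))
  simp_rw [HasMellin, mellin, MellinConvergent, ← indicator_smul, IntegrableOn,
    integrable_indicator_iff measurableSet_Ioi, smul_eq_mul, integral_indicator measurableSet_Ioi,
    IntegrableOn, Measure.restrict_restrict_of_subset (Ioi_subset_Ioi zero_le_one)]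
  rw [← IntegrableOn, ← integrableOn_congr_fun hcongr measurableSet_Ioi,
    ← setIntegral_congr_fun measurableSet_Ioi hcongr]
  refine ⟨integrableOn_Ioi_cpow_of_lt hre one_pos, ?_⟩
  rw [integral_Ioi_cpow_of_lt hre one_pos, ofReal_one, one_cpow, neg_div]
  ring_nf

theorem Gamma_mul_hurwitzZeta_eq_integral (a : ℝ) (ha : 0 < a) (ha' : a ≤ 1)
    (s : ℂ) (hs : -1 < s.re) (hs' : s.re < 0) :
    Complex.Gamma s * hurwitzZeta (a : UnitAddCircle) s =
      ∫ x in Set.Ioi (0 : ℝ),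
        ((Real.exp ((1 - a) * x) / (Real.exp x - 1) - 1 / x - 1 / 2 + a : ℝ) : ℂ) *
          (x : ℂ) ^ (s - 1) := by
  have hs0 : s ≠ 0 := by rintro rfl; simp at hs'
  have hs1 : s ≠ 1 := by rintro rfl; norm_num at hs'
  have h1 := hasMellin_cpow_Ioi (-1) (s := s) (by simp only [neg_re, one_re]; linarith)
  have h0 := hasMellin_cpow_Ioi 0 (s := s) (by simpa using hs')
  have h2 := hasMellin_const_smul h0.1 (1 / 2 - a : ℂ)
  have h3 := hasMellin_add h1.1 h2.1
  have h4 := (hasMellin_sub (mellinConvergent_truncatedKernel ha hs) h3.1).2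
  rw [h3.2, h1.2, h2.2, h0.2, smul_eq_mul, mellin_truncatedKernel ha ha' hs hs0 hs1, add_zero,
    ← sub_eq_add_neg s] at h4
  refine Eq.trans (by ring) (h4.symm.trans ?_)
  refine setIntegral_congr_fun measurableSet_Ioi fun x (hx : 0 < x) ↦ ?_
  rw [smul_eq_mul, mul_comm]
  congr 1
  by_cases hx1 : x ≤ 1
  · simp [truncatedKernel, hx, hx1, hx1.not_gt, cpow_neg_one]
    ring
  · simp [truncatedKernel, hx1, not_le.mp hx1, cpow_neg_one]
    ring
end

section
/- Let 0 < a < 1 and x > 0. Then e^{(1-a)x}/(e^x - 1) - 1/x - 1/2 + a = ∑_{n=1}^∞ ( x e^{-2πina} / (2πin (x - 2πin)) - x e^{2πina} / (2πin (x + 2πin)) ), where the series of complex terms converges absolutely. -/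
open Complex Real

namespace ExpPartialFractions

/-- The function `t ↦ exp ((1 - t) x) / (exp x - 1) - 1 / x - 1 / 2 + t`. -/
noncomputable def expKernel (x : ℝ) (t : ℝ) : ℂ :=
  Complex.exp ((1 - t) * x) / (Complex.exp x - 1) - 1 / x - 1 / 2 + t

lemma exp_ofReal_sub_one_ne_zero {x : ℝ} (hx : x ≠ 0) : Complex.exp x - 1 ≠ 0 := by
  rw [sub_ne_zero, ← Complex.ofReal_exp]
  exact_mod_cast fun h => hx ((Real.exp_eq_one_iff x).1 h)

lemma expKernel_zero_eq_one {x : ℝ} (hx : x ≠ 0) : expKernel x 0 = expKernel x 1 := by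
  have h := exp_ofReal_sub_one_ne_zero hx
  have hx' : (x : ℂ) ≠ 0 := mod_cast hx
  simp only [expKernel, Complex.ofReal_zero, Complex.ofReal_one, sub_zero, one_mul, sub_self,
    zero_mul, Complex.exp_zero]
  field_simp
  ring

lemma continuous_expKernel (x : ℝ) : Continuous (expKernel x) := by
  unfold expKernel
  fun_prop

lemma exp_neg_two_pi_mul_I_mul_int (n : ℤ) : Complex.exp (-(2 * π * I * n)) = 1 := by
  rw [Complex.exp_eq_one_iff]
  exact ⟨-n, by push_cast; ring⟩

lemma ofReal_add_two_pi_mul_I_mul_int_ne_zero {x : ℝ} (hx : x ≠ 0) (n : ℤ) :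
    (x : ℂ) + 2 * π * I * n ≠ 0 := by
  intro h
  apply hx
  simpa using congrArg Complex.re h

lemma integral_expKernel {x : ℝ} (hx : x ≠ 0) : ∫ t in (0 : ℝ)..1, expKernel x t = 0 := by
  have h := exp_ofReal_sub_one_ne_zero hx
  have hx' : (x : ℂ) ≠ 0 := mod_cast hx
  have hd : ∀ t : ℝ, HasDerivAt
      (fun t : ℝ => -Complex.exp ((1 - t) * x) / ((Complex.exp x - 1) * x) - (1 / x + 1 / 2) * t + t ^ 2 / 2)
      (expKernel x t) t := by
    intro t
    have ht : HasDerivAt (fun t : ℝ => (t : ℂ)) 1 t := Complex.ofRealCLM.hasDerivAt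
    have he := ((ht.const_sub 1).mul_const (x : ℂ)).cexp
    convert! ((he.neg.div_const ((Complex.exp x - 1) * x)).sub (ht.const_mul (1 / (x : ℂ) + 1 / 2))).add
      ((ht.pow 2).div_const 2) using 1
    simp only [expKernel]
    field_simp
    ring
  rw [intervalIntegral.integral_eq_sub_of_hasDerivAt (fun t _ => hd t)
    ((continuous_expKernel x).intervalIntegrable 0 1)]
  simp only [Complex.ofReal_zero, Complex.ofReal_one, sub_zero, one_mul, sub_self,
    zero_mul, Complex.exp_zero]
  field_simp
  ring

lemma integral_exp_mul_expKernel {x : ℝ} (hx : x ≠ 0) (n : ℤ) :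
    ∫ t in (0 : ℝ)..1, Complex.exp (-(2 * π * I * n) * t) * expKernel x t =
      -x / (2 * π * I * n * (x + 2 * π * I * n)) := by
  rcases eq_or_ne n 0 with rfl | hn
  · simpa using integral_expKernel hx
  have h := exp_ofReal_sub_one_ne_zero hx
  have hx' : (x : ℂ) ≠ 0 := mod_cast hx
  have hxw := ofReal_add_two_pi_mul_I_mul_int_ne_zero hx n
  have hw : 2 * π * I * n ≠ 0 := mul_ne_zero Complex.two_pi_I_ne_zero (mod_cast hn)
  have hE := exp_neg_two_pi_mul_I_mul_int n
  generalize 2 * π * I * n = w at *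
  have hd : ∀ t : ℝ, HasDerivAt
      (fun t : ℝ => -(Complex.exp (-w * t) * Complex.exp ((1 - t) * x)) / ((Complex.exp x - 1) * (x + w)) -
        (t - 1 / x - 1 / 2) * Complex.exp (-w * t) / w - Complex.exp (-w * t) / w ^ 2)
      (Complex.exp (-w * t) * expKernel x t) t := by
    intro t
    have ht : HasDerivAt (fun t : ℝ => (t : ℂ)) 1 t := Complex.ofRealCLM.hasDerivAt
    have he := ((ht.const_sub 1).mul_const (x : ℂ)).cexp
    have hf := (ht.const_mul (-w)).cexp
    convert! (((hf.mul he).neg.div_const ((Complex.exp x - 1) * (x + w))).sub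
      ((((ht.sub_const (1 / (x : ℂ))).sub_const (1 / 2)).mul hf).div_const w)).sub
      (hf.div_const (w ^ 2)) using 1
    simp only [expKernel]
    field_simp
    ring
  rw [intervalIntegral.integral_eq_sub_of_hasDerivAt (fun t _ => hd t)
    ((by have := continuous_expKernel x; fun_prop : Continuous fun t : ℝ =>
      Complex.exp (-w * t) * expKernel x t).intervalIntegrable 0 1)]
  simp only [Complex.ofReal_zero, Complex.ofReal_one, sub_zero, one_mul, sub_self,
    zero_mul, mul_one, mul_zero, Complex.exp_zero, hE]
  field_simp
  ring

lemma summable_div_mul_add (x : ℝ) :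
    Summable fun n : ℤ => -(x : ℂ) / (2 * π * I * n * (x + 2 * π * I * n)) := by
  refine Summable.of_norm_bounded
    (((Real.summable_one_div_int_pow (p := 2)).2 one_lt_two).mul_left (|x| / (2 * π) ^ 2)) ?_
  intro n
  rcases eq_or_ne n 0 with rfl | hn
  · simp
  have hn' : (0 : ℝ) < |(n : ℝ)| := abs_pos.2 (mod_cast hn)
  have hle : 2 * π * |(n : ℝ)| ≤ ‖(x : ℂ) + 2 * π * I * n‖ := by
    have := Complex.abs_im_le_norm ((x : ℂ) + 2 * π * I * n)
    simpa [abs_mul, abs_of_pos Real.pi_pos] using this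
  have hw : ‖2 * π * I * (n : ℂ)‖ = 2 * π * |(n : ℝ)| := by
    simp [abs_of_pos Real.pi_pos]
  rw [norm_div, norm_mul, hw, norm_neg, Complex.norm_real, Real.norm_eq_abs, div_mul_div_comm,
    mul_one, ← mul_pow, ← sq_abs (2 * π * (n : ℝ)), abs_mul, abs_of_pos Real.two_pi_pos, sq]
  gcongr

theorem hasSum_expKernel {x : ℝ} (hx : x ≠ 0) {a : ℝ} (ha : a ∈ Set.Ico (0 : ℝ) 1) :
    HasSum (fun n : ℤ =>
      -(x : ℂ) / (2 * π * I * n * (x + 2 * π * I * n)) * Complex.exp (2 * π * I * n * a))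
      (expKernel x a) := by
  let B : C(UnitAddCircle, ℂ) := ContinuousMap.mk (AddCircle.liftIco 1 0 (expKernel x))
    (AddCircle.liftIco_zero_continuous (expKernel_zero_eq_one hx)
      (continuous_expKernel x).continuousOn)
  have hB : ∀ n : ℤ, fourierCoeff B n = -(x : ℂ) / (2 * π * I * n * (x + 2 * π * I * n)) := by
    intro n
    rw [ContinuousMap.coe_mk, fourierCoeff_liftIco_eq, fourierCoeffOn_eq_integral,
      ← integral_exp_mul_expKernel hx n]
    simp only [fourier_coe_apply]
    simp
  have key := has_pointwise_sum_fourier_series_of_summable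
    ((summable_div_mul_add x).congr fun n => (hB n).symm) (a : UnitAddCircle)
  simp_rw [hB] at key
  rw [ContinuousMap.coe_mk, AddCircle.liftIco_coe_apply (by rwa [zero_add])] at key
  simpa [fourier_coe_apply] using key

end ExpPartialFractions

open ExpPartialFractions in
theorem G_eq_sum_partial_fractions (a x : ℝ) (ha : 0 < a) (ha' : a < 1) (hx : 0 < x) :
    ((Real.exp ((1 - a) * x) / (Real.exp x - 1) - 1 / x - 1 / 2 + a : ℝ) : ℂ) =
      ∑' n : ℕ,
        ((x : ℂ) * Complex.exp (-(2 * π * I * (n + 1) * a)) /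
            (2 * π * I * (n + 1) * ((x : ℂ) - 2 * π * I * (n + 1))) -
          (x : ℂ) * Complex.exp (2 * π * I * (n + 1) * a) /
            (2 * π * I * (n + 1) * ((x : ℂ) + 2 * π * I * (n + 1)))) := by
  have h := (hasSum_nat_add_iff' 1).2 (hasSum_expKernel hx.ne' ⟨ha.le, ha'⟩).nat_add_neg
  have hG : ((Real.exp ((1 - a) * x) / (Real.exp x - 1) - 1 / x - 1 / 2 + a : ℝ) : ℂ) =
      expKernel x a := by
    simp [expKernel]
  rw [hG]
  refine (HasSum.tsum_eq ?_).symm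
  convert! h using 1
  · ext n
    push_cast
    rw [show 2 * π * I * -((n : ℂ) + 1) * a = -(2 * π * I * (n + 1) * a) by ring,
      show 2 * π * I * -((n : ℂ) + 1) * (x + 2 * π * I * -((n : ℂ) + 1)) =
        -(2 * π * I * (n + 1) * (x - 2 * π * I * (n + 1))) by ring, neg_div_neg_eq]
    ring
  · simp
end

section
/- Let n be a positive integer and let s ∈ ℂ with -1 < Re(s) < 0. Then ∫₀^∞ x^s / (2πin (x - 2πin)) dx = (2π)^s e^{πis/2} n^{s-1} / (1 - e^{2πis}) and ∫₀^∞ x^s / (2πin (x + 2πin)) dx = (2π)^s e^{3πis/2} n^{s-1} / (1 - e^{2πis}), where x^s = exp(s log x) for x > 0 and (2π)^s, n^{s-1} are defined via the real logarithm. -/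
open Complex Real MeasureTheory

lemma integrableOn_cpow_mul_exp_neg_mul_Ioi {a : ℂ} {r : ℝ} (ha : 0 < a.re) (hr : 0 < r) :
    IntegrableOn (fun t : ℝ ↦ (t : ℂ) ^ (a - 1) * Complex.exp (-(r * t))) (Set.Ioi 0) := by
  by_contra h
  refine mul_ne_zero ?_ (Complex.Gamma_ne_zero_of_re_pos ha)
    ((integral_cpow_mul_exp_neg_mul_Ioi ha hr).symm.trans (integral_undef h))
  rw [Ne, cpow_eq_zero_iff, not_and_or]
  exact Or.inl (one_div_ne_zero (ofReal_ne_zero.mpr hr.ne'))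

lemma integrable_cpow_mul_exp_neg_mul_one_add {u : ℂ} (hu : 0 < u.re) (hu' : u.re < 1) :
    Integrable (Function.uncurry fun x t : ℝ ↦
        (x : ℂ) ^ (u - 1) * Complex.exp (-(t * x)) * Complex.exp (-t))
      ((volume.restrict (Set.Ioi 0)).prod (volume.restrict (Set.Ioi 0))) := by
  have hmeas : Measurable (Function.uncurry fun x t : ℝ ↦
        (x : ℂ) ^ (u - 1) * Complex.exp (-(t * x)) * Complex.exp (-t)) := by
    unfold Function.uncurry
    fun_prop
  rw [integrable_prod_iff' hmeas.aestronglyMeasurable]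
  refine ⟨(ae_restrict_mem measurableSet_Ioi).mono fun t ht ↦ ?_, ?_⟩
  · exact (integrableOn_cpow_mul_exp_neg_mul_Ioi hu ht).mul_const (Complex.exp (-t))
  · have hΓ : IntegrableOn (fun t : ℝ ↦ Real.exp (-t) * t ^ ((1 - u.re) - 1) * Real.Gamma u.re)
        (Set.Ioi 0) := (Real.GammaIntegral_convergent (by linarith)).mul_const _
    refine hΓ.congr_fun (fun t ht ↦ ?_) measurableSet_Ioi
    have ht' : (0 : ℝ) < t := ht
    have : ∫ x in Set.Ioi (0 : ℝ),
        ‖(x : ℂ) ^ (u - 1) * Complex.exp (-(t * x)) * Complex.exp (-t)‖ =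
        ∫ x in Set.Ioi (0 : ℝ), x ^ (u.re - 1) * Real.exp (-(t * x)) * Real.exp (-t) := by
      refine setIntegral_congr_fun measurableSet_Ioi fun x hx ↦ ?_
      simp [norm_cpow_eq_rpow_re_of_pos (show (0 : ℝ) < x from hx), Complex.norm_exp]
    simp only [Function.uncurry]
    rw [this, integral_mul_const, Real.integral_rpow_mul_exp_neg_mul_Ioi hu ht',
      one_div, Real.inv_rpow ht'.le, ← Real.rpow_neg ht'.le]
    ring_nf

lemma integral_exp_neg_mul_one_add {x : ℝ} (hx : 0 < x) :
    ∫ t in Set.Ioi (0 : ℝ), Complex.exp (-(t * x)) * Complex.exp (-t) = 1 / (1 + x) := by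
  have h := integral_exp_mul_complex_Ioi (a := -(1 + x : ℂ)) (by simp; linarith) 0
  simp only [ofReal_zero, mul_zero, Complex.exp_zero, neg_div_neg_eq] at h
  rw [← h]
  congr 1 with t
  rw [← Complex.exp_add]
  ring_nf

lemma mellin_one_div_one_add {u : ℂ} (hu : 0 < u.re) (hu' : u.re < 1) :
    HasMellin (fun t : ℝ ↦ (1 / (1 + t) : ℂ)) u (π / Complex.sin (π * u)) := by
  have hint := integrable_cpow_mul_exp_neg_mul_one_add hu hu'
  have hinner : ∀ x ∈ Set.Ioi (0 : ℝ), ∫ t in Set.Ioi (0 : ℝ),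
      (x : ℂ) ^ (u - 1) * Complex.exp (-(t * x)) * Complex.exp (-t) =
      (x : ℂ) ^ (u - 1) • (1 / (1 + x) : ℂ) := fun x hx ↦ by
    simp_rw [mul_assoc]
    rw [integral_const_mul, integral_exp_neg_mul_one_add hx, smul_eq_mul]
  refine ⟨?_, ?_⟩
  · have h := hint.integral_prod_left
    exact IntegrableOn.congr_fun h hinner measurableSet_Ioi
  · rw [mellin, ← setIntegral_congr_fun measurableSet_Ioi hinner, integral_integral_swap hint,
      ← Complex.Gamma_mul_Gamma_one_sub, Complex.Gamma_eq_integral (s := 1 - u) (by simpa),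
      Complex.GammaIntegral, ← integral_const_mul]
    refine setIntegral_congr_fun measurableSet_Ioi fun t ht ↦ ?_
    have ht' : (0 : ℝ) < t := ht
    rw [integral_mul_const, integral_cpow_mul_exp_neg_mul_Ioi hu ht', one_div, ← ofReal_inv,
      ofReal_inv, inv_cpow _ _ (by rw [arg_ofReal_of_nonneg ht'.le]; exact pi_pos.ne),
      ← cpow_neg, sub_sub_cancel_left]
    push_cast
    ring

lemma mellin_one_div_one_add_sq {u : ℂ} (hu : 0 < u.re) (hu' : u.re < 2) :
    HasMellin (fun t : ℝ ↦ (1 / (1 + t ^ 2) : ℂ)) u (π / 2 / Complex.sin (π * u / 2)) := by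
  have h := mellin_one_div_one_add (u := u / 2) (by simpa) (by simp; linarith)
  obtain ⟨f, hf⟩ : ∃ f : ℝ → ℂ, f = fun t : ℝ ↦ (1 / (1 + t) : ℂ) := ⟨_, rfl⟩
  have e : (fun t : ℝ ↦ (1 / (1 + t ^ 2) : ℂ)) = fun t : ℝ ↦ f (t ^ (2 : ℝ)) := by
    ext t
    simp [hf]
  rw [← hf] at h
  rw [e]
  refine ⟨(MellinConvergent.comp_rpow two_ne_zero).mpr (by simpa using h.1), ?_⟩
  rw [mellin_comp_rpow]
  simp only [ofReal_ofNat, h.2, abs_two, Complex.real_smul, ofReal_inv]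
  rw [mul_div_assoc]
  ring

lemma mellin_one_div_add_of_sq_eq_neg_one {u J : ℂ} (hJ : J ^ 2 = -1)
    (hu : 0 < u.re) (hu' : u.re < 1) :
    mellin (fun t : ℝ ↦ 1 / (t + J)) u =
      π / 2 * (1 / Complex.cos (π * u / 2) - J / Complex.sin (π * u / 2)) := by
  have h0 := mellin_one_div_one_add_sq hu (by linarith)
  have h1 := mellin_one_div_one_add_sq (u := u + 1) (by simp; linarith) (by simp; linarith)
  have e : ∀ t ∈ Set.Ioi (0 : ℝ), (t : ℂ) ^ (u - 1) • (1 / (t + J)) =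
      (t : ℂ) ^ (u + 1 - 1) • (1 / (1 + t ^ 2) : ℂ) -
        J * ((t : ℂ) ^ (u - 1) • (1 / (1 + t ^ 2) : ℂ)) := fun t ht ↦ by
    have ht0 : (t : ℂ) ≠ 0 := ofReal_ne_zero.mpr (ne_of_gt ht)
    have hfac : (1 + t ^ 2 : ℂ) = (t + J) * (t - J) := by linear_combination hJ
    have hne : (1 + t ^ 2 : ℂ) ≠ 0 := by
      norm_cast
      positivity
    have h2 := left_ne_zero_of_mul (hfac ▸ hne)
    have h3 := right_ne_zero_of_mul (hfac ▸ hne)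
    rw [hfac, show u + 1 - 1 = (u - 1) + 1 by ring, cpow_add _ _ ht0, cpow_one]
    simp only [smul_eq_mul]
    field_simp
  rw [mellin, setIntegral_congr_fun measurableSet_Ioi e,
    integral_sub h1.1 (Integrable.const_mul h0.1 J), integral_const_mul]
  have h0' := h0.2
  have h1' := h1.2
  rw [mellin] at h0' h1'
  rw [h0', h1', show (π : ℂ) * (u + 1) / 2 = π * u / 2 + π / 2 by ring,
    Complex.sin_add_pi_div_two]
  ring

lemma integral_cpow_div_add {s J : ℂ} {c : ℝ} (hc : 0 < c) (hJ : J ^ 2 = -1)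
    (hs : -1 < s.re) (hs' : s.re < 0) :
    ∫ x in Set.Ioi (0 : ℝ), (x : ℂ) ^ s / (x + c * J) =
      (c : ℂ) ^ s * (-(π / 2) *
        (1 / Complex.sin (π * s / 2) + J / Complex.cos (π * s / 2))) := by
  have hc0 : (c : ℂ) ≠ 0 := ofReal_ne_zero.mpr hc.ne'
  have h := mellin_comp_mul_left (fun t : ℝ ↦ 1 / (t + J)) (s + 1) (inv_pos.mpr hc)
  rw [mellin_one_div_add_of_sq_eq_neg_one hJ (by simp; linarith) (by simp; linarith),
    show (π : ℂ) * (s + 1) / 2 = π * s / 2 + π / 2 by ring,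
    Complex.sin_add_pi_div_two, Complex.cos_add_pi_div_two, mellin, ofReal_inv,
    inv_cpow _ _ (by rw [arg_ofReal_of_nonneg hc.le]; exact pi_pos.ne),
    ← cpow_neg, neg_neg, cpow_add _ _ hc0, cpow_one] at h
  have e : ∀ x : ℝ, (x : ℂ) ^ s / (x + c * J) =
      (c : ℂ)⁻¹ * ((x : ℂ) ^ (s + 1 - 1) • (1 / (((c⁻¹ * x : ℝ) : ℂ) + J))) := fun x ↦ by
    rw [show (x : ℂ) + c * J = c * (((c⁻¹ * x : ℝ) : ℂ) + J) by
      push_cast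
      field_simp, add_sub_cancel_right, smul_eq_mul]
    rw [div_eq_mul_inv, mul_inv, one_div]
    ring
  simp_rw [e]
  rw [integral_const_mul, h, smul_eq_mul]
  field_simp
  ring

theorem integral_xs_div_linear (n : ℕ) (hn : 0 < n) (s : ℂ) (hs : -1 < s.re) (hs' : s.re < 0) :
    (∫ x in Set.Ioi (0 : ℝ), (x : ℂ) ^ s / (2 * π * I * n * ((x : ℂ) - 2 * π * I * n)) =
      ((2 * π : ℝ) : ℂ) ^ s * Complex.exp (π * I * s / 2) * ((n : ℝ) : ℂ) ^ (s - 1) /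
        (1 - Complex.exp (2 * π * I * s))) ∧
    (∫ x in Set.Ioi (0 : ℝ), (x : ℂ) ^ s / (2 * π * I * n * ((x : ℂ) + 2 * π * I * n)) =
      ((2 * π : ℝ) : ℂ) ^ s * Complex.exp (3 * π * I * s / 2) * ((n : ℝ) : ℂ) ^ (s - 1) /
        (1 - Complex.exp (2 * π * I * s))) := by
  have hn0 : (0 : ℝ) < n := Nat.cast_pos.mpr hn
  have hnC : ((n : ℝ) : ℂ) ≠ 0 := ofReal_ne_zero.mpr hn0.ne'
  have hpi : (π : ℂ) ≠ 0 := ofReal_ne_zero.mpr pi_ne_zero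
  have hc : 0 < 2 * π * n := by positivity
  have key : ∀ J : ℂ, J ^ 2 = -1 →
      ∫ x in Set.Ioi (0 : ℝ), (x : ℂ) ^ s / (2 * π * I * n * ((x : ℂ) + (2 * π * n : ℝ) * J)) =
      ((2 * π : ℝ) : ℂ) ^ s * ((n : ℝ) : ℂ) ^ (s - 1) *
        (I / 4 * (1 / Complex.sin (π * s / 2) + J / Complex.cos (π * s / 2))) := fun J hJ ↦ by
    simp_rw [fun x : ℝ ↦ div_mul_eq_div_div_swap ((x : ℂ) ^ s) (2 * π * I * n)]
    rw [integral_div, integral_cpow_div_add hc hJ hs hs', ofReal_mul (2 * π) n,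
      mul_cpow_ofReal_nonneg (by positivity) hn0.le, cpow_sub _ _ hnC, cpow_one]
    have hI : (I : ℂ) ≠ 0 := I_ne_zero
    rw [ofReal_natCast] at *
    field_simp
    rw [I_sq]
    ring
  set E := Complex.exp (π * I * s / 2) with hE
  have hE0 : E ≠ 0 := Complex.exp_ne_zero _
  have hE3 : Complex.exp (3 * π * I * s / 2) = E ^ 3 := by
    rw [hE, ← Complex.exp_nat_mul]
    ring_nf
  have hE4 : Complex.exp (2 * π * I * s) = E ^ 4 := by
    rw [hE, ← Complex.exp_nat_mul]
    ring_nf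
  have hE4' : 1 - E ^ 4 ≠ 0 := by
    rw [← hE4, sub_ne_zero, ne_comm, Ne, Complex.exp_eq_one_iff]
    rintro ⟨m, hm⟩
    have h2 : s = m := by
      have : (2 * π * I : ℂ) ≠ 0 := two_pi_I_ne_zero
      apply mul_left_cancel₀ this
      rw [hm]
      ring
    rw [h2, intCast_re] at hs hs'
    have h3 : -1 < m := by exact_mod_cast hs
    have h4 : m < 0 := by exact_mod_cast hs'
    omega
  have hfac : 1 - E ^ 4 = (1 - E ^ 2) * (1 + E ^ 2) := by ring
  have hm := left_ne_zero_of_mul (hfac ▸ hE4')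
  have hp := right_ne_zero_of_mul (hfac ▸ hE4')
  have hsin : Complex.sin (π * s / 2) = (1 - E ^ 2) * I / (2 * E) := by
    rw [Complex.sin, neg_mul, Complex.exp_neg, show (π : ℂ) * s / 2 * I = π * I * s / 2 by ring,
      ← hE]
    field_simp
  have hcos : Complex.cos (π * s / 2) = (1 + E ^ 2) / (2 * E) := by
    rw [Complex.cos, neg_mul, Complex.exp_neg, show (π : ℂ) * s / 2 * I = π * I * s / 2 by ring,
      ← hE]
    field_simp
    ring
  have hI : (I : ℂ) ≠ 0 := I_ne_zero
  rw [hE3, hE4]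
  constructor
  · have h := key (-I) (by simp)
    have e : ∀ x : ℝ, (x : ℂ) - 2 * π * I * n = (x : ℂ) + (2 * π * n : ℝ) * (-I) := fun x ↦ by
      push_cast
      ring
    simp_rw [e]
    have h' : I / 4 * (1 / Complex.sin (π * s / 2) + -I / Complex.cos (π * s / 2)) =
        E / (1 - E ^ 4) := by
      rw [hsin, hcos, hfac]
      field_simp
      linear_combination (-2 * (1 - E ^ 2)) * I_sq
    rw [h, h']
    ring
  · have h := key I (by simp)
    have e : ∀ x : ℝ, (x : ℂ) + 2 * π * I * n = (x : ℂ) + (2 * π * n : ℝ) * I := fun x ↦ by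
      push_cast
      ring
    simp_rw [e]
    have h' : I / 4 * (1 / Complex.sin (π * s / 2) + I / Complex.cos (π * s / 2)) =
        E ^ 3 / (1 - E ^ 4) := by
      rw [hsin, hcos, hfac]
      field_simp
      linear_combination 2 * (1 - E ^ 2) * I_sq
    rw [h, h']
    ring
end

section
/- Let 0 < a < 1 and let s ∈ ℂ with -1 < Re(s) < 0. Then ζ(s,a) = ((-πi)(2π)^{s-1} / (Γ(s) sin(πs))) · ( e^{πis/2} ∑_{n=1}^∞ e^{2πina} n^{s-1} - e^{-πis/2} ∑_{n=1}^∞ e^{-2πina} n^{s-1} ), where both series converge absolutely since Re(1-s) > 1. -/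
open HurwitzZeta Complex Real

/-- The exponential zeta function as a Dirichlet series summed over positive integers,
written with the variable `1 - s`. -/
theorem hasSum_expZeta_one_sub_of_re_neg (a : ℝ) {s : ℂ} (hs : s.re < 0) :
    HasSum (fun n : ℕ ↦ Complex.exp (2 * π * I * (n + 1) * a) * (((n : ℝ) + 1 : ℝ) : ℂ) ^ (s - 1))
      (expZeta (a : UnitAddCircle) (1 - s)) := by
  have hre : 1 < (1 - s).re := by
    rw [sub_re, one_re]
    linarith
  have hne : 1 - s ≠ 0 := Complex.ne_zero_of_one_lt_re hre
  have h := (hasSum_nat_add_iff' 1).mpr (hasSum_expZeta_of_one_lt_re a hre)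
  simp only [Finset.sum_range_one, Nat.cast_zero, Complex.zero_cpow hne, div_zero, sub_zero] at h
  refine h.congr_fun fun n ↦ ?_
  rw [div_eq_mul_inv, ← Complex.cpow_neg, neg_sub]
  push_cast
  congr 2
  ring

theorem Complex.Gamma_one_sub_eq_div {s : ℂ} (hs : Complex.Gamma s ≠ 0) :
    Complex.Gamma (1 - s) = π / (Complex.Gamma s * Complex.sin (π * s)) := by
  rw [mul_comm, ← div_div, ← Complex.Gamma_mul_Gamma_one_sub, mul_div_cancel_left₀ _ hs]

theorem hurwitzZeta_functional_equation (a : ℝ) (ha : 0 < a) (ha' : a < 1)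
    (s : ℂ) (hs : -1 < s.re) (hs' : s.re < 0) :
    hurwitzZeta (a : UnitAddCircle) s =
      (-(π * I)) * ((2 * π : ℝ) : ℂ) ^ (s - 1) / (Complex.Gamma s * Complex.sin (π * s)) *
        (Complex.exp (π * I * s / 2) *
            ∑' n : ℕ, Complex.exp (2 * π * I * (n + 1) * a) * (((n : ℝ) + 1 : ℝ) : ℂ) ^ (s - 1) -
          Complex.exp (-(π * I * s / 2)) *
            ∑' n : ℕ, Complex.exp (-(2 * π * I * (n + 1) * a)) *
              (((n : ℝ) + 1 : ℝ) : ℂ) ^ (s - 1)) := by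
  have hpos : (∑' n : ℕ, Complex.exp (2 * π * I * (n + 1) * a) *
      (((n : ℝ) + 1 : ℝ) : ℂ) ^ (s - 1)) = expZeta (a : UnitAddCircle) (1 - s) :=
    (hasSum_expZeta_one_sub_of_re_neg a hs').tsum_eq
  have hneg : (∑' n : ℕ, Complex.exp (-(2 * π * I * (n + 1) * a)) *
      (((n : ℝ) + 1 : ℝ) : ℂ) ^ (s - 1)) = expZeta (-(a : UnitAddCircle)) (1 - s) := by
    simpa only [ofReal_neg, mul_neg, AddCircle.coe_neg] using
      (hasSum_expZeta_one_sub_of_re_neg (-a) hs').tsum_eq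
  have hGamma : Complex.Gamma s ≠ 0 := by
    refine Complex.Gamma_ne_zero fun m hm ↦ ?_
    rw [hm] at hs hs'
    simp only [neg_re, natCast_re, neg_lt_neg_iff, Nat.cast_lt_one] at hs
    simp [hs] at hs'
  have hnat (n : ℕ) : 1 - s ≠ -n := fun h ↦ by
    have hre := congrArg Complex.re h
    simp only [sub_re, one_re, neg_re, natCast_re] at hre
    linarith [n.cast_nonneg (α := ℝ)]
  have hone : 1 - s ≠ 1 := fun h ↦ by
    have hre := congrArg Complex.re h
    simp only [sub_re, one_re] at hre
    linarith
  have hexp_neg : Complex.exp (-π * I * (1 - s) / 2) = -I * Complex.exp (π * I * s / 2) := by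
    rw [show -π * I * (1 - s) / 2 = -π / 2 * I + π * I * s / 2 by ring, Complex.exp_add,
      Complex.exp_neg_pi_div_two_mul_I]
  have hexp_pos : Complex.exp (π * I * (1 - s) / 2) = I * Complex.exp (-(π * I * s / 2)) := by
    rw [show π * I * (1 - s) / 2 = π / 2 * I + -(π * I * s / 2) by ring, Complex.exp_add,
      Complex.exp_pi_div_two_mul_I]
  have hfe := hurwitzZeta_one_sub (a : UnitAddCircle) hnat (Or.inr hone)
  rw [sub_sub_cancel, neg_sub, Complex.Gamma_one_sub_eq_div hGamma, hexp_neg, hexp_pos] at hfe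
  rw [hpos, hneg, hfe]
  push_cast
  ring
end

section
/- Let θ be real with 0 < θ < 1 and let σ be real with -1 < σ < 0. Then the analytically continued polylogarithm-type series Li_σ(e^{2πiθ}) = ∑_{n=1}^∞ e^{2πinθ} n^{-σ} (analytic continuation in σ of the series, which converges for Re(σ) > 1) is nonzero. -/
open HurwitzZeta

theorem HurwitzZeta.exists_pos_hurwitzZeta_eq_ofReal {a s : ℝ} (ha : 0 < a) (ha' : a ≤ 1)
    (hs : 1 < s) : ∃ A : ℝ, 0 < A ∧ hurwitzZeta (a : UnitAddCircle) (s : ℂ) = A := by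
  have h := hasSum_hurwitzZeta_of_one_lt_re (s := (s : ℂ)) ⟨ha.le, ha'⟩ (by simpa using hs)
  have hterm (n : ℕ) : 1 / ((n : ℂ) + a) ^ (s : ℂ) = ((1 / ((n : ℝ) + a) ^ s : ℝ) : ℂ) := by
    push_cast [Complex.ofReal_cpow (show (0 : ℝ) ≤ (n : ℝ) + a by positivity)]
    rfl
  simp_rw [hterm] at h
  have hsum : Summable fun n : ℕ ↦ 1 / ((n : ℝ) + a) ^ s := Complex.summable_ofReal.mp h.summable
  refine ⟨∑' n : ℕ, 1 / ((n : ℝ) + a) ^ s,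
    hsum.tsum_pos (fun n ↦ by positivity) 0 (by positivity), ?_⟩
  rw [← h.tsum_eq, Complex.ofReal_tsum]

theorem expZeta_ne_zero_on_neg_one_zero (θ σ : ℝ) (hθ : 0 < θ) (hθ' : θ < 1)
    (hσ : -1 < σ) (hσ' : σ < 0) :
    expZeta (θ : UnitAddCircle) (σ : ℂ) ≠ 0 := by
  obtain ⟨s, rfl⟩ : ∃ s : ℝ, σ = 1 - s := ⟨1 - σ, by ring⟩
  have hs1 : 1 < s := by linarith
  have hs2 : s < 2 := by linarith
  obtain ⟨A, hA, hA'⟩ := exists_pos_hurwitzZeta_eq_ofReal hθ hθ'.le hs1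
  obtain ⟨B, hB, hB'⟩ := exists_pos_hurwitzZeta_eq_ofReal (a := 1 - θ) (by linarith)
    (by linarith) hs1
  have hneg : ((1 - θ : ℝ) : UnitAddCircle) = -(θ : UnitAddCircle) := by
    rw [AddCircle.coe_sub, AddCircle.coe_period, zero_sub]
  have hpole (n : ℕ) : (s : ℂ) ≠ 1 - n := by
    intro h
    have h' : s = 1 - n := by exact_mod_cast h
    linarith [n.cast_nonneg (α := ℝ)]
  have hcos : Real.cos (Real.pi * s / 2) < 0 :=
    Real.cos_neg_of_pi_div_two_lt_of_lt (by nlinarith [Real.pi_pos]) (by nlinarith [Real.pi_pos])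
  rw [Complex.ofReal_sub, Complex.ofReal_one, expZeta_one_sub _ hpole, ← hneg, hA', hB']
  refine mul_ne_zero (mul_ne_zero ?_ ?_) fun h ↦ ?_
  · exact (Complex.cpow_ne_zero_iff_of_exponent_ne_zero
      (by simpa using (by linarith : s ≠ 0))).mpr (by simp [Real.pi_ne_zero])
  · exact Complex.Gamma_ne_zero_of_re_pos (by simpa using by linarith)
  · have hre := congrArg Complex.re h
    rw [show (Real.pi * Complex.I * s / 2 : ℂ) = ((Real.pi * s / 2 : ℝ) : ℂ) * Complex.I by
        push_cast; ring,
      show (-Real.pi * Complex.I * s / 2 : ℂ) = ((-(Real.pi * s / 2) : ℝ) : ℂ) * Complex.I by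
        push_cast; ring,
      Complex.add_re, Complex.re_mul_ofReal, Complex.re_mul_ofReal,
      Complex.exp_ofReal_mul_I_re, Complex.exp_ofReal_mul_I_re, Real.cos_neg, ← mul_add,
      Complex.zero_re] at hre
    exact (mul_neg_of_neg_of_pos hcos (add_pos hA hB)).ne hre
end
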